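/- arXiv:1302.5984 — 2 statements merged into one kernel-verified Lean document; each statement's English description precedes it below -/
import Mathlib

section
/- The series ∑_{n=0}^∞ ((1/4)_n (3/4)_n / (n!)²) · P_n(9/7) · (21/100)^n · (216 − 2385n − 108432n² + 80656n³) converges to 12600√5/π. -/
open Real Filter

/-- The Legendre polynomial of degree `n`, given by the explicit formula
`P_n(x) = 2^{-n} ∑_{j=0}^{n} C(n,j)^2 (x-1)^{n-j} (x+1)^j`. -/
noncomputable def legendreP (n : ℕ) (x : ℝ) : ℝ :=
  (2 : ℝ)⁻¹ ^ n *
    ∑ j ∈ Finset.range (n + 1), (n.choose j : ℝ) ^ 2 * (x - 1) ^ (n - j) * (x + 1) ^ j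

/-- The Pochhammer symbol (rising factorial) `(a)_n = a (a+1) ⋯ (a+n-1)`. -/
noncomputable def poch (a : ℝ) (n : ℕ) : ℝ := (ascPochhammer ℝ n).eval a


/-- The sum of the power series with coefficients `c`. -/
noncomputable def powerSum (c : ℕ → ℝ) (x : ℝ) : ℝ := ∑' n, c n * x ^ n

/-- The power series with coefficients `c` converges on `(-R, R)`. -/
def ConvergesOn (c : ℕ → ℝ) (R : ℝ) : Prop := ∀ x, |x| < R → Summable fun n => c n * x ^ n

/-- `f` is differentiable at `x` and `x f'(x) = f₁`. -/
def HasEulerDerivAt (f : ℝ → ℝ) (f₁ x : ℝ) : Prop := ∃ d, HasDerivAt f d x ∧ x * d = f₁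

namespace HasEulerDerivAt

variable {f g : ℝ → ℝ} {f₁ g₁ x : ℝ}

theorem const (k x : ℝ) : HasEulerDerivAt (fun _ => k) 0 x :=
  ⟨0, hasDerivAt_const x k, by simp⟩

theorem id (x : ℝ) : HasEulerDerivAt (fun y => y) x x :=
  ⟨1, hasDerivAt_id x, by simp⟩

theorem add (hf : HasEulerDerivAt f f₁ x) (hg : HasEulerDerivAt g g₁ x) :
    HasEulerDerivAt (fun y => f y + g y) (f₁ + g₁) x := by
  obtain ⟨d, hd, rfl⟩ := hf
  obtain ⟨d', hd', rfl⟩ := hg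
  exact ⟨_, hd.add hd', by ring⟩

theorem sub (hf : HasEulerDerivAt f f₁ x) (hg : HasEulerDerivAt g g₁ x) :
    HasEulerDerivAt (fun y => f y - g y) (f₁ - g₁) x := by
  obtain ⟨d, hd, rfl⟩ := hf
  obtain ⟨d', hd', rfl⟩ := hg
  exact ⟨_, hd.sub hd', by ring⟩

theorem mul (hf : HasEulerDerivAt f f₁ x) (hg : HasEulerDerivAt g g₁ x) :
    HasEulerDerivAt (fun y => f y * g y) (f₁ * g x + f x * g₁) x := by
  obtain ⟨d, hd, rfl⟩ := hf
  obtain ⟨d', hd', rfl⟩ := hg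
  exact ⟨_, hd.mul hd', by ring⟩

theorem div (hf : HasEulerDerivAt f f₁ x) (hg : HasEulerDerivAt g g₁ x) (h : g x ≠ 0) :
    HasEulerDerivAt (fun y => f y / g y) ((f₁ * g x - f x * g₁) / g x ^ 2) x := by
  obtain ⟨d, hd, rfl⟩ := hf
  obtain ⟨d', hd', rfl⟩ := hg
  exact ⟨_, hd.div hd' h, by ring⟩

theorem pow (hf : HasEulerDerivAt f f₁ x) (n : ℕ) :
    HasEulerDerivAt (fun y => f y ^ n) (n * f x ^ (n - 1) * f₁) x := by
  obtain ⟨d, hd, rfl⟩ := hf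
  exact ⟨_, hd.pow n, by ring⟩

theorem sqrt (hf : HasEulerDerivAt f f₁ x) (h : f x ≠ 0) :
    HasEulerDerivAt (fun y => √(f y)) (f₁ / (2 * √(f x))) x := by
  obtain ⟨d, hd, rfl⟩ := hf
  exact ⟨_, hd.sqrt h, by ring⟩

theorem comp {y : ℝ → ℝ} {k : ℝ} (hf : HasEulerDerivAt f f₁ (y x))
    (hy : HasEulerDerivAt y (k * y x) x) : HasEulerDerivAt (fun z => f (y z)) (k * f₁) x := by
  obtain ⟨d, hd, rfl⟩ := hf
  obtain ⟨d', hd', h⟩ := hy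
  exact ⟨_, hd.comp x hd', by linear_combination d * h⟩

theorem congr_value {f₂ : ℝ} (hf : HasEulerDerivAt f f₁ x) (h : f₁ = f₂) :
    HasEulerDerivAt f f₂ x := h ▸ hf

theorem unique {f₂ : ℝ} (hf : HasEulerDerivAt f f₁ x) (hf' : HasEulerDerivAt f f₂ x) :
    f₁ = f₂ := by
  obtain ⟨d, hd, rfl⟩ := hf
  obtain ⟨d', hd', rfl⟩ := hf'
  rw [hd.unique hd']

theorem congr_of_eventuallyEq (hf : HasEulerDerivAt f f₁ x) (h : g =ᶠ[nhds x] f) :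
    HasEulerDerivAt g f₁ x := by
  obtain ⟨d, hd, rfl⟩ := hf
  exact ⟨d, hd.congr_of_eventuallyEq h, rfl⟩

end HasEulerDerivAt

namespace ConvergesOn

variable {c : ℕ → ℝ} {R : ℝ}

theorem of_abs_le {c : ℕ → ℝ} {k : ℝ} (hk : 0 < k) (hc : ∀ n, |c n| ≤ k ^ n) :
    ConvergesOn c k⁻¹ := by
  intro x hx
  have h1 : k * |x| < 1 := by
    rwa [← lt_inv_mul_iff₀ hk, mul_one]
  refine Summable.of_norm_bounded (summable_geometric_of_lt_one (by positivity) h1) fun n => ?_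
  rw [Real.norm_eq_abs, abs_mul, abs_pow, mul_pow]
  exact mul_le_mul_of_nonneg_right (hc n) (by positivity)

theorem natCast_mul (hc : ConvergesOn c R) : ConvergesOn (fun n => n * c n) R := by
  intro x hx
  obtain ⟨r, hr, hrR⟩ := exists_between hx
  have hr0 : 0 < r := (abs_nonneg x).trans_lt hr
  have hs := hc r (by rwa [abs_of_pos hr0])
  obtain ⟨M, hM⟩ := hs.tendsto_atTop_zero.abs.bddAbove_range
  have hM' : ∀ n, |c n * r ^ n| ≤ M := fun n => hM ⟨n, rfl⟩
  have hq : ‖|x| / r‖ < 1 := by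
    rw [Real.norm_eq_abs, abs_of_nonneg (by positivity), div_lt_one hr0]; exact hr
  refine Summable.of_norm_bounded
    ((summable_pow_mul_geometric_of_norm_lt_one 1 hq).mul_left M) fun n => ?_
  have h1 : ‖(n * c n) * x ^ n‖ = |c n * r ^ n| * ((n : ℝ) ^ 1 * (|x| / r) ^ n) := by
    rw [Real.norm_eq_abs, abs_mul, abs_mul, abs_mul, abs_pow, abs_pow, abs_of_pos hr0, div_pow,
      Nat.abs_cast]
    field_simp
  rw [h1]
  exact mul_le_mul_of_nonneg_right (hM' n) (by positivity)

theorem hasEulerDerivAt (hc : ConvergesOn c R) {x : ℝ} (hx : |x| < R) :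
    HasEulerDerivAt (powerSum c) (powerSum (fun n => n * c n) x) x := by
  obtain ⟨r, hr, hrR⟩ := exists_between hx
  have hr0 : 0 < r := (abs_nonneg x).trans_lt hr
  have hs : Summable fun n : ℕ => |n * c n * r ^ n| * r⁻¹ :=
    (hc.natCast_mul r (by rwa [abs_of_pos hr0])).abs.mul_right _
  have hd : HasDerivAt (powerSum c) (∑' n : ℕ, c n * (n * x ^ (n - 1))) x := by
    refine hasDerivAt_tsum_of_isPreconnected (g := fun n y => c n * y ^ n)
      (g' := fun n y => c n * (n * y ^ (n - 1))) hs Metric.isOpen_ball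
      (convex_ball (0 : ℝ) r).isPreconnected (fun n y _ => ?_) (fun n y hy => ?_)
      (y₀ := 0) (by simpa using hr0) (hc 0 (by simpa using hr0.trans hrR))
      (by simpa using hr)
    · exact (hasDerivAt_pow n y).const_mul (c n)
    · rcases n with _ | n
      · simp
      have hy' : |y| ≤ r := by simpa using (mem_ball_zero_iff.1 hy).le
      rw [Real.norm_eq_abs, abs_mul, abs_mul, abs_mul, abs_mul, abs_pow, abs_pow, abs_of_pos hr0,
        Nat.add_sub_cancel, pow_succ r]
      have : |y| ^ n ≤ r ^ n := by gcongr
      calc |c (n + 1)| * (|((n + 1 : ℕ) : ℝ)| * |y| ^ n)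
          ≤ |c (n + 1)| * (|((n + 1 : ℕ) : ℝ)| * r ^ n) := by gcongr
        _ = _ := by field_simp
  refine ⟨_, hd, ?_⟩
  rw [powerSum, ← tsum_mul_left]
  refine tsum_congr fun n => ?_
  rcases n with _ | n
  · simp
  · rw [Nat.add_sub_cancel]; ring

theorem analyticAt (hc : ConvergesOn c R) {x : ℝ} (hx : |x| < R) : AnalyticAt ℝ (powerSum c) x := by
  obtain ⟨r, hr, hrR⟩ := exists_between hx
  have hr0 : 0 < r := (abs_nonneg x).trans_lt hr
  have hs := hc r (by rwa [abs_of_pos hr0])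
  lift r to NNReal using hr0.le
  have hrad : (r : ENNReal) ≤ (FormalMultilinearSeries.ofScalars ℝ c).radius := by
    refine FormalMultilinearSeries.le_radius_of_summable_norm _ ?_
    refine hs.abs.congr fun n => ?_
    rw [FormalMultilinearSeries.ofScalars_norm, abs_mul, abs_pow, NNReal.abs_eq, Real.norm_eq_abs]
  have h := (FormalMultilinearSeries.ofScalars ℝ c).hasFPowerSeriesOnBall
    (lt_of_lt_of_le (by exact_mod_cast hr0) hrad)
  have h2 : AnalyticAt ℝ (FormalMultilinearSeries.ofScalars ℝ c).sum x := by
    refine h.analyticAt_of_mem (Metric.eball_subset_eball hrad ?_)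
    rw [Metric.mem_eball, edist_zero_right]
    rw [enorm_lt_coe, ← NNReal.coe_lt_coe, coe_nnnorm]
    simpa using hr
  convert h2 using 1
  ext y
  change _ = FormalMultilinearSeries.ofScalarsSum c y
  rw [FormalMultilinearSeries.ofScalarsSum_eq_tsum]
  simp [powerSum]

theorem powerSum_natCast_mul_eq (hc : ConvergesOn c R) {x : ℝ} (hx : |x| < R) :
    powerSum (fun n => n * c n) x = x * powerSum (fun n => (n + 1) * c (n + 1)) x := by
  rw [powerSum, (hc.natCast_mul x hx).tsum_eq_zero_add, powerSum, ← tsum_mul_left]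
  simp only [CharP.cast_eq_zero, zero_mul, zero_add]
  refine tsum_congr fun n => ?_
  push_cast; ring

theorem shift (hc : ConvergesOn c R) : ConvergesOn (fun n => c (n + 1)) R := by
  intro x hx
  rcases eq_or_ne x 0 with rfl | h0
  · refine summable_of_ne_finset_zero (s := {0}) fun n hn => ?_
    simp at hn; simp [hn]
  refine (((summable_nat_add_iff 1).2 (hc x hx)).mul_right x⁻¹).congr fun n => ?_
  rw [pow_succ]; field_simp

end ConvergesOn

theorem powerSum_zero (c : ℕ → ℝ) : powerSum c 0 = c 0 := by
  rw [powerSum, tsum_eq_single 0]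
  · simp
  · intro n hn; simp [hn]

/-- An Abelian theorem: if `c n → l`, then `(1 - x) ∑ c n x ^ n → l` as `x → 1⁻`. -/
theorem tendsto_one_sub_mul_powerSum {c : ℕ → ℝ} {l : ℝ} (h : Tendsto c atTop (nhds l)) :
    Tendsto (fun x => (1 - x) * powerSum c x) (nhdsWithin 1 (Set.Iio 1)) (nhds l) := by
  obtain ⟨M, hM⟩ := h.abs.bddAbove_range
  have hM' : ∀ n, |c n| ≤ M := fun n => hM ⟨n, rfl⟩
  set b : ℕ → ℝ := fun n => Nat.casesOn n (c 0) fun k => c (k + 1) - c k with hb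
  have hsum : ∀ n, ∑ i ∈ Finset.range (n + 1), b i = c n := by
    intro n
    induction n with
    | zero => simp [hb]
    | succ k ih => rw [Finset.sum_range_succ, ih]; simp [hb]
  have hlim : Tendsto (fun n => ∑ i ∈ Finset.range n, b i) atTop (nhds l) := by
    rw [← tendsto_add_atTop_iff_nat 1]
    simpa only [hsum] using h
  refine (Real.tendsto_tsum_powerSeries_nhdsWithin_lt hlim).congr' ?_
  filter_upwards [Ioo_mem_nhdsLT (show (0 : ℝ) < 1 by norm_num)] with x hx
  have hs : Summable fun n => c n * x ^ n := by
    refine Summable.of_norm_bounded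
      ((summable_geometric_of_lt_one hx.1.le hx.2).mul_left M) fun n => ?_
    rw [Real.norm_eq_abs, abs_mul, abs_of_nonneg (pow_nonneg hx.1.le n)]
    exact mul_le_mul_of_nonneg_right (hM' n) (pow_nonneg hx.1.le n)
  have hs1 := (summable_nat_add_iff 1).2 hs
  have hb1 : ∀ n, b (n + 1) * x ^ (n + 1) = c (n + 1) * x ^ (n + 1) - x * (c n * x ^ n) := by
    intro n; simp only [hb]; ring
  have hsb : Summable fun n => b n * x ^ n := by
    rw [← summable_nat_add_iff 1]
    simp only [hb1]
    exact hs1.sub (hs.mul_left x)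
  rw [hsb.tsum_eq_zero_add, powerSum]
  simp only [hb1]
  rw [hs1.tsum_sub (hs.mul_left x), tsum_mul_left, show b 0 = c 0 from rfl]
  linear_combination -hs.tsum_eq_zero_add

/-- The coefficients `(1/4)_n (3/4)_n / (n!)²` of the hypergeometric function
`₂F₁(1/4, 3/4; 1; x)`. -/
noncomputable def quarterCoeff (n : ℕ) : ℝ :=
  poch (1 / 4) n * poch (3 / 4) n / (n.factorial : ℝ) ^ 2

theorem poch_zero (a : ℝ) : poch a 0 = 1 := by simp [poch]

theorem poch_succ (a : ℝ) (n : ℕ) : poch a (n + 1) = poch a n * (a + n) := by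
  rw [poch, ascPochhammer_succ_eval, poch]

theorem poch_eq_prod (a : ℝ) (n : ℕ) : poch a n = ∏ j ∈ Finset.range n, (a + j) := by
  induction n with
  | zero => simp [poch_zero]
  | succ n ih => rw [poch_succ, ih, Finset.prod_range_succ]

theorem quarterCoeff_zero : quarterCoeff 0 = 1 := by simp [quarterCoeff, poch_zero]

theorem quarterCoeff_succ (n : ℕ) :
    ((n : ℝ) + 1) ^ 2 * quarterCoeff (n + 1) = (n + 1 / 4) * (n + 3 / 4) * quarterCoeff n := by
  have h : (n.factorial : ℝ) ≠ 0 := by positivity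
  rw [quarterCoeff, quarterCoeff, poch_succ, poch_succ, Nat.factorial_succ]
  push_cast
  field_simp
  ring

theorem quarterCoeff_mem_Icc (n : ℕ) : quarterCoeff n ∈ Set.Icc (0 : ℝ) 1 := by
  induction n with
  | zero => simp [quarterCoeff_zero]
  | succ n ih =>
    have h : quarterCoeff (n + 1)
        = (n + 1 / 4) * (n + 3 / 4) / ((n : ℝ) + 1) ^ 2 * quarterCoeff n := by
      rw [div_mul_eq_mul_div, eq_div_iff (by positivity), ← quarterCoeff_succ n, mul_comm]
    have h1 : (n + 1 / 4) * (n + 3 / 4) / ((n : ℝ) + 1) ^ 2 ≤ 1 := by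
      rw [div_le_one (by positivity)]; nlinarith [(Nat.cast_nonneg n : (0 : ℝ) ≤ n)]
    rw [h]
    exact ⟨mul_nonneg (by positivity) ih.1, mul_le_one₀ h1 ih.1 ih.2⟩

theorem abs_quarterCoeff_le_one (n : ℕ) : |quarterCoeff n| ≤ 1 := by
  rw [abs_of_nonneg (quarterCoeff_mem_Icc n).1]; exact (quarterCoeff_mem_Icc n).2

theorem convergesOn_quarterCoeff : ConvergesOn quarterCoeff 1 := by
  simpa using ConvergesOn.of_abs_le one_pos (c := quarterCoeff)
    fun n => by simpa using abs_quarterCoeff_le_one n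

theorem tendsto_natCast_mul_quarterCoeff :
    Tendsto (fun n : ℕ => n * quarterCoeff n) atTop (nhds (√2 / (2 * π))) := by
  have hG : Gamma (1 / 4) * Gamma (3 / 4) = √2 * π := by
    have := Real.Gamma_mul_Gamma_one_sub (1 / 4)
    rw [show (1 : ℝ) - 1 / 4 = 3 / 4 by norm_num, show π * (1 / 4) = π / 4 by ring,
      sin_pi_div_four] at this
    rw [this, div_div_eq_mul_div, div_eq_iff (by positivity)]
    linear_combination (-π) * Real.mul_self_sqrt (show (0 : ℝ) ≤ 2 by norm_num)
  have h1 := (((Real.GammaSeq_tendsto_Gamma (1 / 4)).mul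
    (Real.GammaSeq_tendsto_Gamma (3 / 4))).inv₀ (by rw [hG]; positivity)).mul
    (tendsto_natCast_div_add_atTop (1 : ℝ))
  have hl : (Gamma (1 / 4) * Gamma (3 / 4))⁻¹ * 1 = √2 / (2 * π) := by
    rw [hG, mul_one, inv_eq_one_div, div_eq_div_iff (by positivity) (by positivity)]
    linear_combination (-π) * Real.mul_self_sqrt (show (0 : ℝ) ≤ 2 by norm_num)
  rw [hl] at h1
  rw [← tendsto_add_atTop_iff_nat 1]
  refine h1.congr' ?_
  filter_upwards [eventually_gt_atTop 0] with n hn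
  have hn' : (0 : ℝ) < n := by exact_mod_cast hn
  rw [Real.GammaSeq, Real.GammaSeq, ← poch_eq_prod, ← poch_eq_prod, quarterCoeff,
    Nat.factorial_succ]
  have hp : (n : ℝ) ^ (1 / 4 : ℝ) * (n : ℝ) ^ (3 / 4 : ℝ) = n := by
    rw [← rpow_add hn']; norm_num
  have h : (n.factorial : ℝ) ≠ 0 := by positivity
  have h3 : (n : ℝ) ^ (1 / 4 : ℝ) * n.factorial / poch (1 / 4) (n + 1)
      * ((n : ℝ) ^ (3 / 4 : ℝ) * n.factorial / poch (3 / 4) (n + 1))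
      = n * n.factorial ^ 2 / (poch (1 / 4) (n + 1) * poch (3 / 4) (n + 1)) := by
    rw [div_mul_div_comm]; congr 1; linear_combination (n.factorial : ℝ) ^ 2 * hp
  rw [h3, inv_div]
  push_cast
  field_simp

theorem tendsto_quarterCoeff : Tendsto quarterCoeff atTop (nhds 0) := by
  have h := tendsto_natCast_mul_quarterCoeff.mul (tendsto_inv_atTop_nhds_zero_nat (𝕜 := ℝ))
  rw [mul_zero] at h
  refine h.congr' ?_
  filter_upwards [eventually_gt_atTop 0] with n hn
  have hn' : (0 : ℝ) < n := by exact_mod_cast hn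
  field_simp

/-- The hypergeometric function `₂F₁(1/4, 3/4; 1; x)` on `(-1, 1)`. -/
noncomputable def quarterF : ℝ → ℝ := powerSum quarterCoeff

/-- The quasi-derivative `x (1 - x) F'(x)` of `F = ₂F₁(1/4, 3/4; 1; ·)`. -/
noncomputable def quarterPhi (x : ℝ) : ℝ := (1 - x) * powerSum (fun n => n * quarterCoeff n) x

theorem quarterF_zero : quarterF 0 = 1 := by rw [quarterF, powerSum_zero, quarterCoeff_zero]

theorem hasEulerDerivAt_quarterF {x : ℝ} (hx : |x| < 1) :
    HasEulerDerivAt quarterF (quarterPhi x / (1 - x)) x := by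
  refine (convergesOn_quarterCoeff.hasEulerDerivAt hx).congr_value ?_
  have : (1 - x) ≠ 0 := by linarith [(abs_lt.1 hx).2]
  rw [quarterPhi]; field_simp

theorem hasEulerDerivAt_quarterPhi {x : ℝ} (hx : |x| < 1) :
    HasEulerDerivAt quarterPhi (3 / 16 * x * quarterF x) x := by
  have h1 := convergesOn_quarterCoeff.natCast_mul
  refine (((HasEulerDerivAt.const 1 x).sub (.id x)).mul (h1.hasEulerDerivAt hx)).congr_value ?_
  have s0 := convergesOn_quarterCoeff x hx
  have s1 := h1 x hx
  have s2 := h1.natCast_mul x hx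
  have key : powerSum (fun n => n * (n * quarterCoeff n)) x
      = x * (powerSum (fun n => n * (n * quarterCoeff n)) x
        + powerSum (fun n => n * quarterCoeff n) x + 3 / 16 * powerSum quarterCoeff x) := by
    conv_lhs => rw [powerSum, s2.tsum_eq_zero_add]
    simp only [powerSum]
    rw [← tsum_mul_left (a := (3 / 16 : ℝ)), ← s2.tsum_add s1,
      ← (s2.add s1).tsum_add (s0.mul_left _), ← tsum_mul_left]
    simp only [CharP.cast_eq_zero, zero_mul, zero_add]
    refine tsum_congr fun n => ?_
    push_cast
    linear_combination x ^ (n + 1) * quarterCoeff_succ n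
  rw [quarterF]
  linear_combination key

theorem tendsto_one_sub_mul_quarterF :
    Tendsto (fun x => (1 - x) * quarterF x) (nhdsWithin 1 (Set.Iio 1)) (nhds 0) :=
  tendsto_one_sub_mul_powerSum tendsto_quarterCoeff

theorem tendsto_quarterPhi :
    Tendsto quarterPhi (nhdsWithin 1 (Set.Iio 1)) (nhds (√2 / (2 * π))) :=
  tendsto_one_sub_mul_powerSum tendsto_natCast_mul_quarterCoeff

/-- The bilinear form in `F = ₂F₁(1/4, 3/4; 1; ·)` which Legendre's relation evaluates. -/
noncomputable def legendreForm (m : ℝ) : ℝ :=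
  ((2 - m) * (quarterPhi ((m / (2 - m)) ^ 2) * quarterF (((1 - m) / (1 + m)) ^ 2))
    + (1 + m) * (quarterF ((m / (2 - m)) ^ 2) * quarterPhi (((1 - m) / (1 + m)) ^ 2))
    + 3 / 2 * (m * (1 - m)) / ((2 - m) * (1 + m)) *
      (quarterF ((m / (2 - m)) ^ 2) * quarterF (((1 - m) / (1 + m)) ^ 2)))
    / √((2 - m) * (1 + m))

theorem hasEulerDerivAt_legendreForm {m : ℝ} (hm : m ∈ Set.Ioo (0 : ℝ) 1) :
    HasEulerDerivAt legendreForm 0 m := by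
  obtain ⟨h0, h1⟩ := hm
  have k1 : 2 - m ≠ 0 := by linarith
  have k2 : 1 + m ≠ 0 := by linarith
  have k3 : 1 - m ≠ 0 := by linarith
  have k4 : (0 : ℝ) < (2 - m) * (1 + m) := mul_pos (by linarith) (by linarith)
  have k5 : (2 - m) * (1 + m) ≠ 0 := k4.ne'
  have k6 : 1 - (m / (2 - m)) ^ 2 = 4 * (1 - m) / (2 - m) ^ 2 := by field_simp; ring
  have k7 : 1 - ((1 - m) / (1 + m)) ^ 2 = 4 * m / (1 + m) ^ 2 := by field_simp; ring
  have hX : |(m / (2 - m)) ^ 2| < 1 := by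
    rw [abs_of_nonneg (by positivity), ← sub_pos, k6]
    have : 0 < 1 - m := by linarith
    positivity
  have hY : |((1 - m) / (1 + m)) ^ 2| < 1 := by
    rw [abs_of_nonneg (by positivity), ← sub_pos, k7]
    positivity
  have e2 := (HasEulerDerivAt.const 2 m).sub (.id m)
  have e1 := (HasEulerDerivAt.const 1 m).add (.id m)
  have e1' := (HasEulerDerivAt.const 1 m).sub (.id m)
  have dX : HasEulerDerivAt (fun m => (m / (2 - m)) ^ 2)
      (4 / (2 - m) * (m / (2 - m)) ^ 2) m :=
    (((HasEulerDerivAt.id m).div e2 k1).pow 2).congr_value (by push_cast; field_simp; ring)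
  have dY : HasEulerDerivAt (fun m => ((1 - m) / (1 + m)) ^ 2)
      (-4 * m / ((1 - m) * (1 + m)) * ((1 - m) / (1 + m)) ^ 2) m :=
    ((e1'.div e1 k2).pow 2).congr_value (by push_cast; field_simp; ring)
  have dF1 := HasEulerDerivAt.comp (y := fun m => (m / (2 - m)) ^ 2)
    (hasEulerDerivAt_quarterF hX) dX
  have dF2 := HasEulerDerivAt.comp (y := fun m => ((1 - m) / (1 + m)) ^ 2)
    (hasEulerDerivAt_quarterF hY) dY
  have dP1 := HasEulerDerivAt.comp (y := fun m => (m / (2 - m)) ^ 2)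
    (hasEulerDerivAt_quarterPhi hX) dX
  have dP2 := HasEulerDerivAt.comp (y := fun m => ((1 - m) / (1 + m)) ^ 2)
    (hasEulerDerivAt_quarterPhi hY) dY
  have d := ((((e2.mul (dP1.mul dF2)).add (e1.mul (dF1.mul dP2))).add
    ((((HasEulerDerivAt.const (3 / 2) m).mul ((HasEulerDerivAt.id m).mul e1')).div
      (e2.mul e1) k5).mul (dF1.mul dF2))).div ((e2.mul e1).sqrt k5) (sqrt_pos.2 k4).ne')
  refine d.congr_value ?_
  rw [div_eq_zero_iff]
  left
  rw [k6, k7]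
  generalize quarterF ((m / (2 - m)) ^ 2) = F1
  generalize quarterPhi ((m / (2 - m)) ^ 2) = P1
  generalize quarterF (((1 - m) / (1 + m)) ^ 2) = F2
  generalize quarterPhi (((1 - m) / (1 + m)) ^ 2) = P2
  have hs0 := (sqrt_pos.2 k4).ne'
  have hs := Real.sq_sqrt k4.le
  generalize √((2 - m) * (1 + m)) = s at hs hs0
  field_simp
  rw [hs]
  ring

theorem tendsto_legendreForm :
    Tendsto legendreForm (nhdsWithin 0 (Set.Ioi 0)) (nhds (1 / (2 * π))) := by
  have of_cont : ∀ {f : ℝ → ℝ}, ContinuousAt f 0 →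
      Tendsto f (nhdsWithin 0 (Set.Ioi 0)) (nhds (f 0)) :=
    fun h => h.tendsto.mono_left nhdsWithin_le_nhds
  have hX : Tendsto (fun m : ℝ => (m / (2 - m)) ^ 2) (nhdsWithin 0 (Set.Ioi 0)) (nhds 0) := by
    have h : ContinuousAt (fun m : ℝ => (m / (2 - m)) ^ 2) 0 := by
      fun_prop (disch := norm_num)
    simpa using of_cont h
  have hY : Tendsto (fun m : ℝ => ((1 - m) / (1 + m)) ^ 2) (nhdsWithin 0 (Set.Ioi 0))
      (nhdsWithin 1 (Set.Iio 1)) := by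
    refine tendsto_nhdsWithin_iff.2 ⟨?_, ?_⟩
    · have h : ContinuousAt (fun m : ℝ => ((1 - m) / (1 + m)) ^ 2) 0 := by
        fun_prop (disch := norm_num)
      simpa using of_cont h
    · filter_upwards [self_mem_nhdsWithin] with m hm
      have hm' : (0 : ℝ) < m := hm
      rw [Set.mem_Iio, div_pow, div_lt_one (by positivity)]
      nlinarith
  have hF1 : Tendsto (fun m : ℝ => quarterF ((m / (2 - m)) ^ 2)) (nhdsWithin 0 (Set.Ioi 0))
      (nhds 1) := by
    have h := (convergesOn_quarterCoeff.analyticAt (x := 0) (by simp)).continuousAt.tendsto.comp hX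
    rwa [powerSum_zero, quarterCoeff_zero] at h
  have hs := (convergesOn_quarterCoeff.natCast_mul.shift.analyticAt
    (x := 0) (by simp)).continuousAt.tendsto.comp hX
  have hP2 := tendsto_quarterPhi.comp hY
  have hF2 : Tendsto (fun m : ℝ => m * quarterF (((1 - m) / (1 + m)) ^ 2))
      (nhdsWithin 0 (Set.Ioi 0)) (nhds 0) := by
    have h := (tendsto_one_sub_mul_quarterF.comp hY).mul
      (of_cont (show ContinuousAt (fun m : ℝ => (1 + m) ^ 2 / 4) 0 by fun_prop))
    rw [zero_mul] at h
    refine h.congr' ?_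
    filter_upwards [self_mem_nhdsWithin] with m hm
    have hm' : (0 : ℝ) < m := hm
    simp only [Function.comp]
    field_simp
    ring
  have hc1 := of_cont (show ContinuousAt (fun m : ℝ => m / (2 - m) * (1 - (m / (2 - m)) ^ 2)) 0 by
    fun_prop (disch := norm_num))
  have hc2 := of_cont (show ContinuousAt (fun m : ℝ => 1 + m) 0 by fun_prop)
  have hc3 := of_cont (show ContinuousAt (fun m : ℝ => 3 / 2 * (1 - m) / ((2 - m) * (1 + m))) 0 by
    fun_prop (disch := norm_num))
  have hc4 := of_cont (show ContinuousAt (fun m : ℝ => √((2 - m) * (1 + m))) 0 by fun_prop)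
  have hlim := ((((hc1.mul hs).mul hF2).add (hc2.mul (hF1.mul hP2))).add
    (hc3.mul (hF1.mul hF2))).div hc4 (by norm_num)
  norm_num at hlim
  rw [show 1 / (2 * π) = √2 / (2 * π) / √2 by field_simp]
  refine hlim.congr' ?_
  filter_upwards [Ioo_mem_nhdsGT (show (0 : ℝ) < 1 by norm_num)] with m hm
  have hX1 : |(m / (2 - m)) ^ 2| < 1 := by
    have : 0 < 2 - m := by linarith [hm.2]
    have h0 := hm.1
    rw [abs_of_nonneg (by positivity), div_pow, div_lt_one (by positivity)]
    nlinarith [hm.2]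
  have k1 : 2 - m ≠ 0 := by linarith [hm.2]
  have k2 : 1 + m ≠ 0 := by linarith [hm.1]
  simp only [Pi.div_apply, legendreForm, quarterPhi]
  rw [convergesOn_quarterCoeff.powerSum_natCast_mul_eq hX1]
  congr 1
  field_simp

theorem legendreForm_eq {m : ℝ} (hm : m ∈ Set.Ioo (0 : ℝ) 1) : legendreForm m = 1 / (2 * π) := by
  have hd : ∀ y ∈ Set.Ioo (0 : ℝ) 1, HasDerivAt legendreForm 0 y := by
    intro y hy
    obtain ⟨d, hd, h⟩ := hasEulerDerivAt_legendreForm hy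
    rwa [(mul_eq_zero.1 h).resolve_left hy.1.ne'] at hd
  refine tendsto_nhds_unique ?_ tendsto_legendreForm
  refine tendsto_const_nhds.congr' ?_
  filter_upwards [Ioo_mem_nhdsGT (show (0 : ℝ) < 1 by norm_num)] with y hy
  exact isOpen_Ioo.is_const_of_deriv_eq_zero isPreconnected_Ioo
    (fun z hz => (hd z hz).differentiableAt.differentiableWithinAt)
    (fun z hz => (hd z hz).deriv) hm hy

theorem legendre_relation_one_third :
    63000 * (quarterPhi (1 / 25) * quarterF (1 / 4))
      + 50400 * (quarterF (1 / 25) * quarterPhi (1 / 4))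
      + 5670 * (quarterF (1 / 25) * quarterF (1 / 4)) = 12600 * √5 / π := by
  have h := legendreForm_eq (m := 1 / 3) (by norm_num)
  have hs : √((2 - 1 / 3) * (1 + 1 / 3)) = 2 * √5 / 3 := by
    rw [show ((2 : ℝ) - 1 / 3) * (1 + 1 / 3) = (2 / 3) ^ 2 * 5 by norm_num,
      Real.sqrt_mul (by norm_num), Real.sqrt_sq (by norm_num)]
    ring
  rw [legendreForm, hs, show ((1 / 3 : ℝ) / (2 - 1 / 3)) ^ 2 = 1 / 25 by norm_num,
    show ((1 - 1 / 3 : ℝ) / (1 + 1 / 3)) ^ 2 = 1 / 4 by norm_num,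
    div_eq_div_iff (by positivity) (by positivity)] at h
  rw [eq_div_iff (by positivity)]
  linear_combination 18900 * h

namespace ConvergesOn

variable {c : ℕ → ℝ} {R : ℝ}

theorem pow_mul (hc : ConvergesOn c R) (k : ℕ) : ConvergesOn (fun n => (n : ℝ) ^ k * c n) R := by
  induction k with
  | zero => simpa using hc
  | succ k ih => simpa only [pow_succ', mul_assoc] using ih.natCast_mul

theorem hasEulerDerivAt_pow_mul (hc : ConvergesOn c R) (k : ℕ) {x : ℝ} (hx : |x| < R) :
    HasEulerDerivAt (powerSum fun n => (n : ℝ) ^ k * c n)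
      (powerSum (fun n => (n : ℝ) ^ (k + 1) * c n) x) x := by
  simpa only [pow_succ', mul_assoc] using (hc.pow_mul k).hasEulerDerivAt hx

end ConvergesOn

open Polynomial in
/-- The polynomial `∑ C(n,j)² X^j`, a Legendre polynomial after a Möbius change of variable. -/
noncomputable def chooseSqPoly (n : ℕ) : ℝ[X] :=
  ∑ j ∈ Finset.range (n + 1), C ((n.choose j : ℝ) ^ 2) * X ^ j

theorem coeff_chooseSqPoly (n j : ℕ) : (chooseSqPoly n).coeff j = (n.choose j : ℝ) ^ 2 := by
  simp only [chooseSqPoly, Polynomial.finsetSum_coeff, Polynomial.coeff_C_mul_X_pow]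
  rw [Finset.sum_ite_eq]
  split_ifs with h
  · rfl
  · rw [Finset.mem_range, not_lt] at h
    rw [Nat.choose_eq_zero_of_lt (by omega)]; simp

theorem eval_chooseSqPoly (n : ℕ) (y : ℝ) :
    (chooseSqPoly n).eval y = ∑ j ∈ Finset.range (n + 1), (n.choose j : ℝ) ^ 2 * y ^ j := by
  simp [chooseSqPoly, Polynomial.eval_finsetSum]

theorem choose_succ_mul_cast (n k : ℕ) :
    (n.choose (k + 1) : ℝ) * (k + 1) = n.choose k * (n - k) := by
  rcases le_or_gt k n with h | h
  · have := Nat.choose_succ_right_eq n k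
    have h2 : ((n.choose (k + 1) * (k + 1) : ℕ) : ℝ) = (n.choose k * (n - k) : ℕ) := by rw [this]
    push_cast [Nat.cast_sub h] at h2
    exact h2
  · rw [Nat.choose_eq_zero_of_lt h, Nat.choose_eq_zero_of_lt (by omega)]; simp

open Polynomial in
/-- The three-term recurrence of the Legendre polynomials, in terms of `chooseSqPoly`. -/
theorem chooseSqPoly_recurrence (n : ℕ) :
    C ((n : ℝ) + 2) * chooseSqPoly (n + 2)
      = C (2 * (n : ℝ) + 3) * (chooseSqPoly (n + 1) + chooseSqPoly (n + 1) * X)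
        - C ((n : ℝ) + 1) * (chooseSqPoly n - C 2 * (chooseSqPoly n * X)
          + chooseSqPoly n * X * X) := by
  ext j
  simp only [coeff_sub, coeff_add, coeff_C_mul]
  rcases j with _ | _ | j
  · simp only [coeff_mul_X_zero, coeff_chooseSqPoly, Nat.choose_zero_right]
    push_cast; ring
  · have h1 : ∀ p : ℝ[X], (p * X).coeff 1 = p.coeff 0 := fun p => coeff_mul_X p 0
    simp only [zero_add, h1, coeff_mul_X_zero, coeff_chooseSqPoly, Nat.choose_zero_right,
      Nat.choose_one_right]
    push_cast; ring
  · simp only [coeff_mul_X, coeff_chooseSqPoly]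
    have h1 := choose_succ_mul_cast n j
    have h2 := choose_succ_mul_cast n (j + 1)
    rw [Nat.choose_succ_succ' (n + 1) (j + 1), Nat.choose_succ_succ' n (j + 1),
      Nat.choose_succ_succ' n j]
    push_cast at h1 h2 ⊢
    generalize (n.choose j : ℝ) = a at *
    generalize (n.choose (j + 1) : ℝ) = b at *
    generalize (n.choose (j + 2) : ℝ) = c at *
    linear_combination 2 * (a + b) * h2 - 2 * (b + c) * h1

/-- The coefficients of the series in the statement, without the polynomial weight. -/
noncomputable def legendreCoeff (n : ℕ) : ℝ :=
  quarterCoeff n * legendreP n (9 / 7) * (21 / 100) ^ n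

theorem legendreCoeff_eq (n : ℕ) :
    legendreCoeff n = quarterCoeff n * ((3 / 100) ^ n * (chooseSqPoly n).eval 8) := by
  have h : legendreP n (9 / 7) = (1 / 7) ^ n * (chooseSqPoly n).eval 8 := by
    rw [legendreP, eval_chooseSqPoly, Finset.mul_sum, Finset.mul_sum]
    refine Finset.sum_congr rfl fun j hj => ?_
    have hj' : j ≤ n := by simpa [Nat.lt_succ_iff] using hj
    obtain ⟨i, rfl⟩ := Nat.exists_eq_add_of_le hj'
    rw [Nat.add_sub_cancel_left, show (9 / 7 : ℝ) - 1 = 2 * (1 / 7) by norm_num,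
      show (9 / 7 : ℝ) + 1 = 2 * (1 / 7) * 8 by norm_num, pow_add, pow_add, mul_pow _ (8 : ℝ),
      mul_pow, mul_pow]
    have e : ∀ k, (2⁻¹ : ℝ) ^ k * 2 ^ k = 1 := fun k => by rw [← mul_pow]; norm_num
    linear_combination ((j + i).choose j : ℝ) ^ 2 * 8 ^ j * (1 / 7) ^ i * (1 / 7) ^ j
      * (e j * ((2⁻¹ : ℝ) ^ i * 2 ^ i) + e i)
  rw [legendreCoeff, h, show (3 / 100 : ℝ) = 1 / 7 * (21 / 100) by norm_num, mul_pow]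
  ring

theorem convergesOn_legendreCoeff : ConvergesOn legendreCoeff 2 := by
  have := ConvergesOn.of_abs_le (c := legendreCoeff) (k := 1 / 2) (by norm_num) fun n => ?_
  · simpa using this
  have h1 : (chooseSqPoly n).eval 8 ≤ 16 ^ n := by
    rw [eval_chooseSqPoly]
    calc ∑ j ∈ Finset.range (n + 1), (n.choose j : ℝ) ^ 2 * 8 ^ j
        ≤ ∑ j ∈ Finset.range (n + 1), ((3 : ℝ) ^ j * n.choose j) ^ 2 := by
          refine Finset.sum_le_sum fun j _ => ?_
          rw [mul_pow, mul_comm, ← pow_mul, mul_comm j, pow_mul]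
          gcongr
          norm_num
      _ ≤ (∑ j ∈ Finset.range (n + 1), (3 : ℝ) ^ j * n.choose j) ^ 2 :=
          Finset.sum_sq_le_sq_sum_of_nonneg fun j _ => by positivity
      _ = 16 ^ n := by
          have h := add_pow (3 : ℝ) 1 n
          simp only [one_pow, mul_one] at h
          rw [← h, ← pow_mul, mul_comm, pow_mul]
          norm_num
  have h0 : 0 ≤ (chooseSqPoly n).eval 8 := by
    rw [eval_chooseSqPoly]; exact Finset.sum_nonneg fun j _ => by positivity
  rw [legendreCoeff_eq, abs_mul, abs_of_nonneg (a := (3 / 100 : ℝ) ^ n * _) (by positivity)]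
  calc |quarterCoeff n| * ((3 / 100) ^ n * (chooseSqPoly n).eval 8)
      ≤ 1 * ((3 / 100) ^ n * 16 ^ n) := by
        gcongr
        exact abs_quarterCoeff_le_one n
    _ = (48 / 100) ^ n := by rw [one_mul, ← mul_pow]; norm_num
    _ ≤ (1 / 2) ^ n := pow_le_pow_left₀ (by norm_num) (by norm_num) n

theorem legendreCoeff_recurrence (n : ℕ) :
    ((n : ℝ) + 1) * (n + 2) ^ 3 * legendreCoeff (n + 2)
      = 27 / 100 * ((n + 1) * (2 * n + 3) * (n + 5 / 4) * (n + 7 / 4)) * legendreCoeff (n + 1)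
        - 441 / 10000 * ((n + 1 / 4) * (n + 3 / 4) * (n + 5 / 4) * (n + 7 / 4))
          * legendreCoeff n := by
  have hq := congrArg (Polynomial.eval (8 : ℝ)) (chooseSqPoly_recurrence n)
  simp only [Polynomial.eval_mul, Polynomial.eval_sub, Polynomial.eval_add, Polynomial.eval_C,
    Polynomial.eval_X] at hq
  have h0 := quarterCoeff_succ n
  have h1 := quarterCoeff_succ (n + 1)
  push_cast at h1
  simp only [legendreCoeff_eq]
  rw [pow_succ _ (n + 1), pow_succ]
  linear_combination (3 / 100) ^ n * (9 / 10000) * ((n + 1) * (n + 2) *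
    (chooseSqPoly (n + 2)).eval 8 * h1
    + (n + 1) * (n + 5 / 4) * (n + 7 / 4) * quarterCoeff (n + 1) * hq
    - (n + 5 / 4) * (n + 7 / 4) * 49 * (chooseSqPoly n).eval 8 * h0)

/-- The series `∑ n^k a_n t^n` with `a_n` the coefficients of the statement. -/
noncomputable def legendreSeries (k : ℕ) : ℝ → ℝ :=
  powerSum fun n => (n : ℝ) ^ k * legendreCoeff n

theorem legendreSeries_ode {t : ℝ} (ht : |t| < 2) :
    (1 - 54 / 100 * t + 441 / 10000 * t ^ 2) * legendreSeries 4 t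
      = legendreSeries 3 t + 27 / 100 * t * (3 * legendreSeries 3 t + 11 / 8 * legendreSeries 2 t
          + 3 / 16 * legendreSeries 1 t)
        - 441 / 10000 * t ^ 2 * (4 * legendreSeries 3 t + 43 / 8 * legendreSeries 2 t
          + 11 / 4 * legendreSeries 1 t + 105 / 256 * legendreSeries 0 t) := by
  have hs : ∀ k, HasSum (fun n : ℕ => (n : ℝ) ^ k * legendreCoeff n * t ^ n)
      (legendreSeries k t) := fun k => (convergesOn_legendreCoeff.pow_mul k t ht).hasSum
  have h2 : HasSum (fun n : ℕ => ((n : ℝ) + 1) * (n + 2) ^ 3 * legendreCoeff (n + 2) * t ^ (n + 2))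
      (legendreSeries 4 t - legendreSeries 3 t) := by
    have h := (hasSum_nat_add_iff' 2).2 ((hs 4).sub (hs 3))
    simp only [Finset.sum_range_succ, Finset.sum_range_zero] at h
    norm_num at h
    refine h.congr_fun fun n => ?_
    ring
  have h1 : HasSum (fun n : ℕ => ((n : ℝ) + 1) * (2 * n + 3) * (n + 5 / 4) * (n + 7 / 4)
      * legendreCoeff (n + 1) * t ^ (n + 1))
      (2 * legendreSeries 4 t + 3 * legendreSeries 3 t + 11 / 8 * legendreSeries 2 t
          + 3 / 16 * legendreSeries 1 t) := by
    have h := (hasSum_nat_add_iff' 1).2 (((((hs 4).mul_left 2).add ((hs 3).mul_left 3)).add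
      ((hs 2).mul_left (11 / 8))).add ((hs 1).mul_left (3 / 16)))
    norm_num at h
    refine h.congr_fun fun n => ?_
    ring
  have h0 : HasSum (fun n : ℕ => ((n : ℝ) + 1 / 4) * (n + 3 / 4) * (n + 5 / 4) * (n + 7 / 4)
      * legendreCoeff n * t ^ n)
      (legendreSeries 4 t + 4 * legendreSeries 3 t + 43 / 8 * legendreSeries 2 t
          + 11 / 4 * legendreSeries 1 t + 105 / 256 * legendreSeries 0 t) := by
    refine (((((hs 4).add ((hs 3).mul_left 4)).add ((hs 2).mul_left (43 / 8))).add
      ((hs 1).mul_left (11 / 4))).add ((hs 0).mul_left (105 / 256))).congr_fun fun n => ?_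
    ring
  have key := h2.unique (((h1.mul_left (27 / 100 * t)).sub
    (h0.mul_left (441 / 10000 * t ^ 2))).congr_fun fun n => ?_)
  · linear_combination key
  · linear_combination t ^ (n + 2) * legendreCoeff_recurrence n

theorem ConvergesOn.hasDerivAt_zero {c : ℕ → ℝ} {R : ℝ} (hc : ConvergesOn c R) (hR : 0 < R) :
    HasDerivAt (powerSum c) (c 1) 0 := by
  have h := ((hasDerivAt_id (0 : ℝ)).mul (hc.shift.analyticAt
    (x := 0) (by simpa using hR)).differentiableAt.hasDerivAt).const_add (c 0)
  rw [powerSum_zero] at h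
  simp only [id, one_mul, zero_mul, add_zero, zero_add] at h
  refine h.congr_of_eventuallyEq ?_
  filter_upwards [Ioo_mem_nhds (neg_lt_zero.2 hR) hR] with x hx
  change _ = c 0 + x * _
  rw [powerSum, (hc x (abs_lt.2 hx)).tsum_eq_zero_add, powerSum, ← tsum_mul_left, pow_zero, mul_one]
  congr 1
  exact tsum_congr fun n => by ring

/-- A solution of a fourth-order linear equation with a regular singular point at `0` whose indicial
polynomial is `n³ (n - 1)` vanishes identically if it vanishes to second order at `0`. -/
theorem eventuallyEq_zero_of_indicial {δ : ℕ → ℝ → ℝ} {ρ b₀ b₁ b₂ b₃ : ℝ → ℝ}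
    (hρ : AnalyticAt ℝ ρ 0) (hρ0 : ρ 0 = 1) (hδ : AnalyticAt ℝ (δ 0) 0) (hδ0 : δ 0 0 = 0)
    (hδ1 : HasDerivAt (δ 0) 0 0)
    (hstep : ∀ k < 4, ∀ᶠ e in nhds 0, HasEulerDerivAt (δ k) (ρ e * δ (k + 1) e) e)
    (hode : ∀ᶠ e in nhds 0,
      δ 4 e = b₃ e * δ 3 e + b₂ e * δ 2 e + b₁ e * δ 1 e + b₀ e * δ 0 e)
    (hb₃ : Tendsto b₃ (nhds 0) (nhds 1)) (hb₂ : Tendsto b₂ (nhds 0) (nhds 0))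
    (hb₁ : Tendsto b₁ (nhds 0) (nhds 0)) (hb₀ : Tendsto b₀ (nhds 0) (nhds 0)) :
    δ 0 =ᶠ[nhds 0] 0 := by
  by_contra hne
  obtain ⟨n, g, hg, hg0, hgn⟩ := hδ.exists_eventuallyEq_pow_smul_nonzero_iff.2 hne
  simp only [sub_zero, smul_eq_mul] at hgn
  have hρne : ∀ᶠ e in nhds 0, ρ e ≠ 0 :=
    hρ.continuousAt.eventually_ne (by rw [hρ0]; exact one_ne_zero)
  have hk : ∀ k ≤ 4, ∃ h : ℝ → ℝ, AnalyticAt ℝ h 0 ∧ h 0 = (n : ℝ) ^ k * g 0 ∧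
      ∀ᶠ e in nhds 0, δ k e = e ^ n * h e := by
    intro k
    induction k with
    | zero => exact fun _ => ⟨g, hg, by simp, hgn⟩
    | succ k ih =>
      intro hk4
      obtain ⟨h, hh, hh0, hhe⟩ := ih (by omega)
      refine ⟨fun e => (n * h e + e * deriv h e) / ρ e, ?_, ?_, ?_⟩
      · exact ((analyticAt_const.mul hh).add (analyticAt_id.mul hh.deriv)).div hρ
          (by rw [hρ0]; exact one_ne_zero)
      · simp only [hρ0, hh0]; ring
      · filter_upwards [hstep k (by omega), hhe.eventually_nhds, hρne,
          hh.eventually_analyticAt] with e he1 he2 he3 he4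
        have hd : HasEulerDerivAt h (e * deriv h e) e :=
          ⟨_, he4.differentiableAt.hasDerivAt, rfl⟩
        have := he1.unique ((((HasEulerDerivAt.id e).pow n).mul hd).congr_of_eventuallyEq he2)
        rw [mul_div_assoc', eq_div_iff he3, mul_comm, this]
        rcases n with _ | n
        · simp
        · rw [Nat.add_sub_cancel]; ring
  obtain ⟨h₁, hh₁, hz₁, he₁⟩ := hk 1 (by norm_num)
  obtain ⟨h₂, hh₂, hz₂, he₂⟩ := hk 2 (by norm_num)
  obtain ⟨h₃, hh₃, hz₃, he₃⟩ := hk 3 (by norm_num)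
  obtain ⟨h₄, hh₄, hz₄, he₄⟩ := hk 4 (by norm_num)
  have hlim := (((hb₃.mul hh₃.continuousAt.tendsto).add (hb₂.mul hh₂.continuousAt.tendsto)).add
    (hb₁.mul hh₁.continuousAt.tendsto)).add (hb₀.mul hg.continuousAt.tendsto)
  have heq : h₄ 0 = 1 * h₃ 0 + 0 * h₂ 0 + 0 * h₁ 0 + 0 * g 0 := by
    refine tendsto_nhds_unique (hh₄.continuousAt.tendsto.mono_left nhdsWithin_le_nhds)
      ((hlim.mono_left (nhdsWithin_le_nhds (s := {0}ᶜ))).congr' ?_)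
    filter_upwards [self_mem_nhdsWithin, nhdsWithin_le_nhds hgn, nhdsWithin_le_nhds he₁,
      nhdsWithin_le_nhds he₂, nhdsWithin_le_nhds he₃, nhdsWithin_le_nhds he₄,
      nhdsWithin_le_nhds hode] with e e0 k0 k1 k2 k3 k4 k5
    have e0' : e ^ n ≠ 0 := pow_ne_zero n e0
    refine mul_left_cancel₀ e0' ?_
    rw [← k4, k5, k3, k2, k1, k0]; ring
  rw [hz₃, hz₄] at heq
  have hn : (n : ℝ) ^ 3 * ((n : ℝ) - 1) = 0 := by
    refine (mul_eq_zero.1 ?_).resolve_right hg0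
    linear_combination heq
  rcases mul_eq_zero.1 hn with hn | hn
  · have hn' : n = 0 := by simpa using hn
    subst hn'
    have := hgn.self_of_nhds
    simp only [hδ0, pow_zero, one_mul] at this
    exact hg0 this.symm
  · have hn' : n = 1 := by exact_mod_cast sub_eq_zero.1 hn
    subst hn'
    have hd := ((hasDerivAt_id (0 : ℝ)).mul hg.differentiableAt.hasDerivAt).congr_of_eventuallyEq
      (f₁ := δ 0) (by simpa [EventuallyEq, id] using hgn)
    have := hδ1.unique hd
    simp only [id, one_mul, zero_mul, add_zero] at this
    exact hg0 this.symm

/-- The iterated Euler derivatives of the product `F(X) F(Y)` with respect to the variable of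
Brafman's series, as bilinear forms in `F` and its quasi-derivative. From the fourth on they are written in
terms of the previous ones through the differential equation satisfied by the series. -/
noncomputable def brafmanForm : ℕ → ℝ → ℝ → ℝ
  | 0, X, Y => quarterF X * quarterF Y
  | 1, X, Y => (quarterPhi X * quarterF Y + quarterF X * quarterPhi Y) / (1 - X - Y)
  | 2, X, Y =>
    (3 / 16 * (X * (1 - X) + Y * (1 - Y)) * (quarterF X * quarterF Y)
      + 2 * (quarterPhi X * quarterPhi Y)) / (1 - X - Y) ^ 2
    + (X * (1 - X) + Y * (1 - Y)) * (quarterPhi X * quarterF Y + quarterF X * quarterPhi Y)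
      / (1 - X - Y) ^ 3
  | 3, X, Y =>
    ((3 / 16 * (X * (1 - X) * (1 - 2 * X) + Y * (1 - Y) * (1 - 2 * Y)) * (quarterF X * quarterF Y)
      + 3 / 16 * (X * (1 - X) + Y * (1 - Y))
        * (quarterPhi X * quarterF Y + quarterF X * quarterPhi Y)
      + 3 / 8 * (X * (1 - X) * (quarterF X * quarterPhi Y)
        + Y * (1 - Y) * (quarterPhi X * quarterF Y))) * (1 - X - Y) ^ 2
    + (3 * (X * (1 - X) + Y * (1 - Y)) * (3 / 16 * (X * (1 - X) + Y * (1 - Y))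
        * (quarterF X * quarterF Y) + 2 * (quarterPhi X * quarterPhi Y))
      + (X * (1 - X) * (1 - 2 * X) + Y * (1 - Y) * (1 - 2 * Y))
        * (quarterPhi X * quarterF Y + quarterF X * quarterPhi Y)) * (1 - X - Y)
    + 3 * (X * (1 - X) + Y * (1 - Y)) ^ 2
      * (quarterPhi X * quarterF Y + quarterF X * quarterPhi Y)) / (1 - X - Y) ^ 5
  | k + 4, X, Y =>
    (brafmanForm (k + 3) X Y
      + (X + Y - 2 * X * Y) * (3 * brafmanForm (k + 3) X Y + 11 / 8 * brafmanForm (k + 2) X Y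
        + 3 / 16 * brafmanForm (k + 1) X Y)
      - (Y - X) ^ 2 * (4 * brafmanForm (k + 3) X Y + 43 / 8 * brafmanForm (k + 2) X Y
        + 11 / 4 * brafmanForm (k + 1) X Y + 105 / 256 * brafmanForm k X Y)) / (1 - X - Y) ^ 2

section

variable {X Y : ℝ → ℝ} {e : ℝ}

theorem hasEulerDerivAt_brafmanForm (hX : HasEulerDerivAt X ((1 - X e) * X e) e)
    (hY : HasEulerDerivAt Y ((1 - Y e) * Y e) e) (hX1 : |X e| < 1) (hY1 : |Y e| < 1)
    (hρ : 1 - X e - Y e ≠ 0) : ∀ k < 4, HasEulerDerivAt (fun e => brafmanForm k (X e) (Y e))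
      ((1 - X e - Y e) * brafmanForm (k + 1) (X e) (Y e)) e := by
  have c : ∀ r, HasEulerDerivAt (fun _ => r) 0 e := fun r => .const r e
  have k1 : 1 - X e ≠ 0 := by linarith [(abs_lt.1 hX1).2]
  have k2 : 1 - Y e ≠ 0 := by linarith [(abs_lt.1 hY1).2]
  have dF1 := ((hasEulerDerivAt_quarterF hX1).comp hX).congr_value (f₂ := quarterPhi (X e))
    (by field_simp)
  have dF2 := ((hasEulerDerivAt_quarterF hY1).comp hY).congr_value (f₂ := quarterPhi (Y e))
    (by field_simp)
  have dP1 := (hasEulerDerivAt_quarterPhi hX1).comp hX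
  have dP2 := (hasEulerDerivAt_quarterPhi hY1).comp hY
  have dρ := (((c 1).sub hX).sub hY)
  have d1 := (dP1.mul dF2).add (dF1.mul dP2)
  have d0 := dF1.mul dF2
  have dPP := dP1.mul dP2
  have dp := hX.mul ((c 1).sub hX)
  have dq := hY.mul ((c 1).sub hY)
  have dpq := dp.add dq
  have dpq' := (dp.mul ((c 1).sub ((c 2).mul hX))).add (dq.mul ((c 1).sub ((c 2).mul hY)))
  intro k hk
  interval_cases k
  · refine d0.congr_value ?_
    simp only [brafmanForm]
    field_simp
  · refine (d1.div dρ hρ).congr_value ?_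
    simp only [brafmanForm]
    generalize quarterF (X e) = F1
    generalize quarterPhi (X e) = P1
    generalize quarterF (Y e) = F2
    generalize quarterPhi (Y e) = P2
    field_simp
    ring
  · refine ((((((c (3 / 16)).mul dpq).mul d0).add ((c 2).mul dPP)).div (dρ.pow 2)
      (pow_ne_zero 2 hρ)).add ((dpq.mul d1).div (dρ.pow 3) (pow_ne_zero 3 hρ))).congr_value ?_
    simp only [brafmanForm]
    generalize quarterF (X e) = F1
    generalize quarterPhi (X e) = P1
    generalize quarterF (Y e) = F2
    generalize quarterPhi (Y e) = P2
    push_cast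
    field_simp
    ring
  · have dA := (((c (3 / 16)).mul dpq').mul d0).add (((c (3 / 16)).mul dpq).mul d1)
    have dB := dA.add ((c (3 / 8)).mul ((dp.mul (dF1.mul dP2)).add (dq.mul (dP1.mul dF2))))
    have dC := ((c 3).mul dpq).mul ((((c (3 / 16)).mul dpq).mul d0).add ((c 2).mul dPP))
    have dD := (((dB.mul (dρ.pow 2)).add ((dC.add (dpq'.mul d1)).mul dρ)).add
      (((c 3).mul (dpq.pow 2)).mul d1)).div (dρ.pow 5) (pow_ne_zero 5 hρ)
    refine dD.congr_value ?_
    simp only [brafmanForm]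
    generalize quarterF (X e) = F1
    generalize quarterPhi (X e) = P1
    generalize quarterF (Y e) = F2
    generalize quarterPhi (Y e) = P2
    push_cast
    field_simp
    ring

end

/-- The difference between the `k`-th Euler derivative of the Legendre series and of Brafman's
product, along the rational curve `X = e/(e+24)`, `Y = e/(e+3)`. -/
noncomputable def brafmanDefect (k : ℕ) (e : ℝ) : ℝ :=
  legendreSeries k (100 * e / ((e + 24) * (e + 3))) - brafmanForm k (e / (e + 24)) (e / (e + 3))

theorem brafmanCurve_bounds {e : ℝ} (he : e ∈ Set.Ioo (-1 / 2 : ℝ) 2) :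
    |e / (e + 24)| < 1 ∧ |e / (e + 3)| < 1 ∧ |100 * e / ((e + 24) * (e + 3))| < 2 ∧
      0 < 1 - e / (e + 24) - e / (e + 3) := by
  obtain ⟨h1, h2⟩ := he
  have k1 : 0 < e + 24 := by linarith
  have k2 : 0 < e + 3 := by linarith
  have k3 := mul_pos k1 k2
  refine ⟨?_, ?_, ?_, ?_⟩
  · rw [abs_lt, lt_div_iff₀ k1, div_lt_iff₀ k1]; constructor <;> linarith
  · rw [abs_lt, lt_div_iff₀ k2, div_lt_iff₀ k2]; constructor <;> linarith
  · rw [abs_lt, lt_div_iff₀ k3, div_lt_iff₀ k3]; constructor <;> nlinarith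
  · have : 1 - e / (e + 24) - e / (e + 3) = (72 - e ^ 2) / ((e + 24) * (e + 3)) := by
      field_simp; ring
    rw [this]
    exact div_pos (by nlinarith) k3

theorem hasEulerDerivAt_brafmanDefect {e : ℝ} (he : e ∈ Set.Ioo (-1 / 2 : ℝ) 2) :
    ∀ k < 4, HasEulerDerivAt (brafmanDefect k)
      ((1 - e / (e + 24) - e / (e + 3)) * brafmanDefect (k + 1) e) e := by
  intro k hk
  obtain ⟨hX, hY, ht, hρ⟩ := brafmanCurve_bounds he
  have k1 : e + 24 ≠ 0 := by linarith [he.1]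
  have k2 : e + 3 ≠ 0 := by linarith [he.1]
  have d24 := (HasEulerDerivAt.id e).add (.const 24 e)
  have d3 := (HasEulerDerivAt.id e).add (.const 3 e)
  have dX : HasEulerDerivAt (fun e => e / (e + 24)) ((1 - e / (e + 24)) * (e / (e + 24))) e :=
    ((HasEulerDerivAt.id e).div d24 k1).congr_value (by field_simp; ring)
  have dY : HasEulerDerivAt (fun e => e / (e + 3)) ((1 - e / (e + 3)) * (e / (e + 3))) e :=
    ((HasEulerDerivAt.id e).div d3 k2).congr_value (by field_simp; ring)
  have dt : HasEulerDerivAt (fun e => 100 * e / ((e + 24) * (e + 3)))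
      ((1 - e / (e + 24) - e / (e + 3)) * (100 * e / ((e + 24) * (e + 3)))) e :=
    (((HasEulerDerivAt.const 100 e).mul (.id e)).div (d24.mul d3)
      (mul_ne_zero k1 k2)).congr_value (by field_simp; ring)
  refine ((HasEulerDerivAt.comp (y := fun e => 100 * e / ((e + 24) * (e + 3)))
    (convergesOn_legendreCoeff.hasEulerDerivAt_pow_mul k ht) dt).sub
    (hasEulerDerivAt_brafmanForm dX dY hX hY hρ.ne' k hk)).congr_value ?_
  rw [brafmanDefect, legendreSeries]
  ring

theorem brafmanDefect_ode {e : ℝ} (he : e ∈ Set.Ioo (-1 / 2 : ℝ) 2) {t ρ : ℝ}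
    (ht : t = 100 * e / ((e + 24) * (e + 3))) (hρ : ρ = 1 - e / (e + 24) - e / (e + 3)) :
    brafmanDefect 4 e
      = (1 + 81 / 100 * t - 441 / 2500 * t ^ 2) / ρ ^ 2 * brafmanDefect 3 e
        + (297 / 800 * t - 18963 / 80000 * t ^ 2) / ρ ^ 2 * brafmanDefect 2 e
        + (81 / 1600 * t - 4851 / 40000 * t ^ 2) / ρ ^ 2 * brafmanDefect 1 e
        + (-(9261 / 512000) * t ^ 2) / ρ ^ 2 * brafmanDefect 0 e := by
  obtain ⟨-, -, ht2, hρ0⟩ := brafmanCurve_bounds he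
  have k1 : e + 24 ≠ 0 := by linarith [he.1]
  have k2 : e + 3 ≠ 0 := by linarith [he.1]
  rw [← ht] at ht2
  rw [← hρ] at hρ0
  have hρ2 : 1 - 54 / 100 * t + 441 / 10000 * t ^ 2 = ρ ^ 2 := by
    rw [hρ, ht]; field_simp; ring
  have hT : e / (e + 24) + e / (e + 3) - 2 * (e / (e + 24)) * (e / (e + 3)) = 27 / 100 * t := by
    rw [ht]; field_simp; ring
  have hZ : (e / (e + 3) - e / (e + 24)) ^ 2 = 441 / 10000 * t ^ 2 := by
    rw [ht]; field_simp; ring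
  have h := legendreSeries_ode ht2
  rw [hρ2, mul_comm, ← eq_div_iff (by positivity)] at h
  simp only [brafmanDefect, ← ht]
  have hB : ∀ X Y : ℝ, brafmanForm 4 X Y =
      (brafmanForm 3 X Y + (X + Y - 2 * X * Y) *
          (3 * brafmanForm 3 X Y + 11 / 8 * brafmanForm 2 X Y + 3 / 16 * brafmanForm 1 X Y) -
        (Y - X) ^ 2 * (4 * brafmanForm 3 X Y + 43 / 8 * brafmanForm 2 X Y +
          11 / 4 * brafmanForm 1 X Y + 105 / 256 * brafmanForm 0 X Y)) / (1 - X - Y) ^ 2 :=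
    fun X Y => brafmanForm.eq_5 X Y 0
  rw [h, hB, hT, hZ, ← hρ]
  field_simp
  ring

theorem analyticAt_brafmanDefect_zero {e : ℝ} (he : e ∈ Set.Ioo (-1 / 2 : ℝ) 2) :
    AnalyticAt ℝ (brafmanDefect 0) e := by
  obtain ⟨hX, hY, ht, -⟩ := brafmanCurve_bounds he
  have k1 : e + 24 ≠ 0 := by linarith [he.1]
  have k2 : e + 3 ≠ 0 := by linarith [he.1]
  have k3 := mul_ne_zero k1 k2
  have aX := (convergesOn_quarterCoeff.analyticAt hX).fun_comp (f := fun e => e / (e + 24))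
    (by fun_prop (disch := assumption))
  have aY := (convergesOn_quarterCoeff.analyticAt hY).fun_comp (f := fun e => e / (e + 3))
    (by fun_prop (disch := assumption))
  have aT := ((convergesOn_legendreCoeff.pow_mul 0).analyticAt ht).fun_comp
    (f := fun e => 100 * e / ((e + 24) * (e + 3))) (by fun_prop (disch := assumption))
  exact aT.sub (aX.mul aY)

theorem legendreCoeff_zero : legendreCoeff 0 = 1 := by
  simp [legendreCoeff_eq, quarterCoeff_zero, eval_chooseSqPoly]

theorem quarterCoeff_one : quarterCoeff 1 = 3 / 16 := by
  have h := quarterCoeff_succ 0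
  rw [quarterCoeff_zero] at h
  norm_num at h
  exact h

theorem legendreCoeff_one : legendreCoeff 1 = 81 / 1600 := by
  rw [legendreCoeff_eq, quarterCoeff_one, eval_chooseSqPoly]
  norm_num [Finset.sum_range_succ]

theorem brafmanDefect_zero_zero : brafmanDefect 0 0 = 0 := by
  simp [brafmanDefect, legendreSeries, brafmanForm, powerSum_zero, legendreCoeff_zero,
    quarterF_zero]

theorem hasDerivAt_brafmanDefect_zero : HasDerivAt (brafmanDefect 0) 0 0 := by
  have dl := (convergesOn_legendreCoeff.pow_mul 0).hasDerivAt_zero (by norm_num)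
  have dq := convergesOn_quarterCoeff.hasDerivAt_zero one_pos
  have d24 := (hasDerivAt_id (0 : ℝ)).add_const 24
  have d3 := (hasDerivAt_id (0 : ℝ)).add_const 3
  have dX := (hasDerivAt_id (0 : ℝ)).div d24 (by norm_num)
  have dY := (hasDerivAt_id (0 : ℝ)).div d3 (by norm_num)
  have dt := ((hasDerivAt_id (0 : ℝ)).const_mul 100).div (d24.mul d3) (by norm_num)
  have d := (dl.comp_of_eq 0 dt (by norm_num)).sub
    ((dq.comp_of_eq 0 dX (by norm_num)).mul (dq.comp_of_eq 0 dY (by norm_num)))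
  refine HasDerivAt.congr_deriv (f := brafmanDefect 0) d ?_
  simp [legendreCoeff_one, quarterCoeff_one, powerSum_zero, quarterCoeff_zero]
  norm_num

theorem brafmanDefect_zero_eq_zero :
    Set.EqOn (brafmanDefect 0) 0 (Set.Ioo (-1 / 2 : ℝ) 2) := by
  have h0 : (0 : ℝ) ∈ Set.Ioo (-1 / 2 : ℝ) 2 := by norm_num
  have hnhds : ∀ᶠ e in nhds (0 : ℝ), e ∈ Set.Ioo (-1 / 2 : ℝ) 2 := Ioo_mem_nhds h0.1 h0.2
  refine AnalyticOnNhd.eqOn_zero_of_preconnected_of_eventuallyEq_zero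
    (fun e he => analyticAt_brafmanDefect_zero he) isPreconnected_Ioo h0 ?_
  have aux : ∀ {f : ℝ → ℝ} {l : ℝ}, ContinuousAt f 0 → f 0 = l → Tendsto f (nhds 0) (nhds l) :=
    fun hf hl => hl ▸ hf.tendsto
  refine eventuallyEq_zero_of_indicial
    (ρ := fun e => 1 - e / (e + 24) - e / (e + 3)) ?_ (by norm_num)
    (analyticAt_brafmanDefect_zero h0) brafmanDefect_zero_zero hasDerivAt_brafmanDefect_zero
    (fun k hk => hnhds.mono fun e he => hasEulerDerivAt_brafmanDefect he k hk)
    (hnhds.mono fun e he => brafmanDefect_ode he rfl rfl) (aux ?_ ?_) (aux ?_ ?_) (aux ?_ ?_)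
    (aux ?_ ?_)
  · fun_prop (disch := norm_num)
  all_goals first | fun_prop (disch := norm_num) | norm_num

theorem brafmanDefect_eq_zero : ∀ k ≤ 4, Set.EqOn (brafmanDefect k) 0 (Set.Ioo (-1 / 2 : ℝ) 2) := by
  intro k
  induction k with
  | zero => exact fun _ => brafmanDefect_zero_eq_zero
  | succ k ih =>
    intro hk e he
    have h1 := hasEulerDerivAt_brafmanDefect he k (by omega)
    have h2 : brafmanDefect k =ᶠ[nhds e] fun _ => 0 :=
      (ih (by omega)).eventuallyEq_of_mem (Ioo_mem_nhds he.1 he.2)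
    have h3 := h1.unique ((HasEulerDerivAt.const 0 e).congr_of_eventuallyEq h2)
    exact (mul_eq_zero.1 h3).resolve_left (brafmanCurve_bounds he).2.2.2.ne'

theorem legendreSeries_one {k : ℕ} (hk : k ≤ 4) :
    legendreSeries k 1 = brafmanForm k (1 / 25) (1 / 4) := by
  have h := brafmanDefect_eq_zero k hk (show (1 : ℝ) ∈ Set.Ioo (-1 / 2 : ℝ) 2 by norm_num)
  norm_num [brafmanDefect] at h
  norm_num
  exact sub_eq_zero.1 h

theorem stmt11 :
    Tendsto (fun N => ∑ n ∈ Finset.range N,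
      (poch (1 / 4) n * poch (3 / 4) n / (n.factorial : ℝ) ^ 2) * legendreP n (9 / 7) *
        (21 / 100) ^ n * (216 - 2385 * (n : ℝ) - 108432 * (n : ℝ) ^ 2 + 80656 * (n : ℝ) ^ 3))
      atTop (nhds (12600 * Real.sqrt 5 / π)) := by
  have hs : ∀ k, HasSum (fun n : ℕ => (n : ℝ) ^ k * legendreCoeff n * 1 ^ n)
      (legendreSeries k 1) :=
    fun k => (convergesOn_legendreCoeff.pow_mul k 1 (by norm_num)).hasSum
  have h := ((((hs 0).mul_left 216).sub ((hs 1).mul_left 2385)).sub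
    ((hs 2).mul_left 108432)).add ((hs 3).mul_left 80656)
  rw [legendreSeries_one (by norm_num), legendreSeries_one (by norm_num),
    legendreSeries_one (by norm_num), legendreSeries_one (by norm_num)] at h
  have hval : 216 * brafmanForm 0 (1 / 25) (1 / 4) - 2385 * brafmanForm 1 (1 / 25) (1 / 4)
      - 108432 * brafmanForm 2 (1 / 25) (1 / 4) + 80656 * brafmanForm 3 (1 / 25) (1 / 4)
      = 12600 * √5 / π := by
    rw [← legendre_relation_one_third]
    simp only [brafmanForm]
    ring
  rw [hval] at h
  refine h.tendsto_sum_nat.congr fun N => Finset.sum_congr rfl fun n _ => ?_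
  rw [legendreCoeff, quarterCoeff, one_pow]
  ring
end

section
/- The series ∑_{n=0}^∞ ((1/4)_n (1/2)_n (3/4)_n / (n!)³) · (32/81)^n · (1 + 7n) converges to 9/(2π). -/
open Real Filter

theorem poch_pos {a : ℝ} (ha : 0 < a) (n : ℕ) : 0 < poch a n := by
  induction n with
  | zero => simp [poch_zero]
  | succ n ih => rw [poch_succ]; positivity

theorem poch_half_le_factorial (n : ℕ) : poch (1 / 2) n ≤ n.factorial := by
  induction n with
  | zero => simp [poch_zero]
  | succ n ih =>
    rw [poch_succ, Nat.factorial_succ, mul_comm (n + 1)]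
    push_cast
    gcongr ?_ * ?_
    linarith

theorem poch_quarter_mul_poch_three_quarters (n : ℕ) :
    poch (1 / 4) n * poch (3 / 4) n = poch (1 / 2) (2 * n) / 4 ^ n := by
  induction n with
  | zero => simp [poch_zero]
  | succ n ih =>
    rw [show 2 * (n + 1) = 2 * n + 1 + 1 by ring, poch_succ _ n, poch_succ _ n, poch_succ,
      poch_succ, mul_mul_mul_comm, ih, pow_succ]
    push_cast
    field_simp
    ring

theorem factorial_two_mul_eq (n : ℕ) :
    ((2 * n).factorial : ℝ) = 4 ^ n * n.factorial * poch (1 / 2) n := by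
  induction n with
  | zero => simp [poch_zero]
  | succ n ih =>
    rw [show 2 * (n + 1) = 2 * n + 1 + 1 by ring, Nat.factorial_succ, Nat.factorial_succ,
      Nat.factorial_succ n, poch_succ, pow_succ]
    push_cast
    rw [ih]
    ring

/-- The square of `(1/2)_k / k!` in terms of the partial Wallis products. -/
theorem sq_poch_half_div_factorial (k : ℕ) :
    (poch (1 / 2) k / k.factorial) ^ 2 = 1 / ((2 * k + 1) * Wallis.W k) := by
  rw [Wallis.W_eq_factorial_ratio, factorial_two_mul_eq, pow_mul]
  have := (poch_pos (a := 1 / 2) (by norm_num) k).ne'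
  have h : (4 ^ k : ℝ) ^ 2 = (2 ^ 4) ^ k := by rw [← pow_mul, mul_comm, pow_mul]; norm_num
  simp only [mul_pow, h]
  field_simp

/-- The hypergeometric part of a Wilf–Zeilberger pair. -/
noncomputable def wzTerm (n k : ℕ) : ℝ :=
  (-1 / 8) ^ n * poch (1 / 2) n ^ 2 * poch (1 / 2) (2 * k + n) /
    (4 ^ k * n.factorial * (n + k).factorial ^ 2)

theorem wzTerm_succ_left (n k : ℕ) :
    wzTerm (n + 1) k = wzTerm n k *
      (-1 / 8 * (n + 1 / 2) ^ 2 * (2 * k + n + 1 / 2) / ((n + 1) * (n + k + 1) ^ 2)) := by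
  unfold wzTerm
  rw [← add_assoc, poch_succ, poch_succ, Nat.factorial_succ, show n + 1 + k = n + k + 1 by ring,
    Nat.factorial_succ, pow_succ]
  push_cast
  field_simp
  ring

theorem wzTerm_succ_right (n k : ℕ) :
    wzTerm n (k + 1) = wzTerm n k *
      ((2 * k + n + 1 / 2) * (2 * k + n + 3 / 2) / (4 * (n + k + 1) ^ 2)) := by
  unfold wzTerm
  rw [← add_assoc, show 2 * (k + 1) + n = 2 * k + n + 1 + 1 by ring, poch_succ, poch_succ,
    Nat.factorial_succ, pow_succ]
  push_cast
  field_simp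
  ring

theorem wzTerm_zero_left (k : ℕ) :
    wzTerm 0 k =
      (poch (1 / 2) (2 * k) / (2 * k).factorial) * (poch (1 / 2) k / k.factorial) := by
  have := (poch_pos (a := 1 / 2) (by norm_num) k).ne'
  rw [factorial_two_mul_eq]
  simp only [wzTerm, poch_zero, pow_zero, Nat.factorial_zero, zero_add, add_zero]
  push_cast
  field_simp

theorem wzTerm_zero_left_pos (k : ℕ) : 0 < wzTerm 0 k := by
  have := poch_pos (a := 1 / 2) (by norm_num) k
  have := poch_pos (a := 1 / 2) (by norm_num) (2 * k)
  rw [wzTerm_zero_left]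
  positivity

theorem wz_pair (n k : ℕ) :
    wzTerm n (k + 1) * (6 * n + 1 + 4 * (k + 1 : ℕ)) - wzTerm n k * (6 * n + 1 + 4 * k) =
      4 * (n + 1 : ℕ) * wzTerm (n + 1) k - 4 * n * wzTerm n k := by
  rw [wzTerm_succ_left, wzTerm_succ_right]
  push_cast
  field_simp
  ring

theorem abs_wzTerm_succ_le (n k : ℕ) :
    |wzTerm (n + 1) k| ≤ wzTerm 0 k * (1 / 4) ^ (n + 1) / (k + 1) := by
  have hk := wzTerm_zero_left_pos k
  induction n with
  | zero =>
    rw [wzTerm_succ_left, abs_mul, abs_of_pos hk, mul_div_assoc (wzTerm 0 k)]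
    gcongr ?_ * ?_
    rw [abs_div, abs_of_nonneg (a := ((0 : ℕ) + 1) * (((0 : ℕ) : ℝ) + k + 1) ^ 2) (by positivity),
      abs_mul, abs_mul, abs_of_nonneg (a := 2 * (k : ℝ) + (0 : ℕ) + 1 / 2) (by positivity),
      abs_of_nonneg (a := (((0 : ℕ) : ℝ) + 1 / 2) ^ 2) (by positivity),
      div_le_div_iff₀ (by positivity) (by positivity)]
    norm_num
    have : (0 : ℝ) ≤ k := k.cast_nonneg
    nlinarith [this, mul_nonneg this this]
  | succ n ih =>
    rw [wzTerm_succ_left, abs_mul, pow_succ _ (n + 1), ← mul_assoc, mul_div_right_comm _ (1 / 4)]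
    refine mul_le_mul ih ?_ (abs_nonneg _) ((abs_nonneg _).trans ih)
    rw [abs_div, abs_of_nonneg (a := ((n + 1 : ℕ) + 1) * (((n + 1 : ℕ) : ℝ) + k + 1) ^ 2)
        (by positivity),
      abs_mul, abs_mul, abs_of_nonneg (a := 2 * (k : ℝ) + (n + 1 : ℕ) + 1 / 2) (by positivity),
      abs_of_nonneg (a := (((n + 1 : ℕ) : ℝ) + 1 / 2) ^ 2) (by positivity),
      div_le_div_iff₀ (by positivity) (by positivity)]
    have hn : (0 : ℝ) ≤ (n + 1 : ℕ) := Nat.cast_nonneg _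
    generalize ((n + 1 : ℕ) : ℝ) = x at hn
    have hk0 : (0 : ℝ) ≤ k := k.cast_nonneg
    generalize (k : ℝ) = y at hk0
    rw [show |(-1 / 8 : ℝ)| = 1 / 8 by norm_num [abs_div]]
    have h1 : (x + 1 / 2) ^ 2 ≤ (x + 1) * (x + y + 1) := by nlinarith [mul_nonneg hn hk0]
    have h2 : 2 * y + x + 1 / 2 ≤ 2 * (x + y + 1) := by linarith
    calc 1 / 8 * (x + 1 / 2) ^ 2 * (2 * y + x + 1 / 2) * 4
        ≤ 1 / 8 * ((x + 1) * (x + y + 1)) * (2 * (x + y + 1)) * 4 := by gcongr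
      _ = 1 * ((x + 1) * (x + y + 1) ^ 2) := by ring

theorem summable_geometric_mul_linear {r : ℝ} (hr : 0 ≤ r) (hr' : r < 1) (a b : ℝ) :
    Summable fun n : ℕ => r ^ n * (a * n + b) := by
  have h0 := summable_geometric_of_lt_one hr hr'
  have h1 : Summable fun n : ℕ => (n : ℝ) ^ 1 * r ^ n :=
    summable_pow_mul_geometric_of_norm_lt_one 1 (by rwa [norm_of_nonneg hr])
  refine ((h1.mul_left a).add (h0.mul_left b)).congr fun n => ?_
  ring

theorem abs_wzTerm_succ_mul_le (n k : ℕ) :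
    |wzTerm (n + 1) k * (6 * (n + 1 : ℕ) + 1 + 4 * k)| ≤
      wzTerm 0 k * ((1 / 4) ^ (n + 1) * (6 * (n + 1 : ℕ) + 1)) := by
  have hk := wzTerm_zero_left_pos k
  rw [abs_mul, abs_of_nonneg (a := 6 * ((n + 1 : ℕ) : ℝ) + 1 + 4 * k) (by positivity)]
  refine (mul_le_mul_of_nonneg_right (abs_wzTerm_succ_le n k) (by positivity)).trans ?_
  rw [div_mul_eq_mul_div, div_le_iff₀ (by positivity), ← mul_assoc, mul_assoc _ _ ((k : ℝ) + 1)]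
  gcongr
  push_cast
  nlinarith [(n.cast_nonneg : (0 : ℝ) ≤ n), (k.cast_nonneg : (0 : ℝ) ≤ k),
    mul_nonneg (n.cast_nonneg : (0 : ℝ) ≤ n) (k.cast_nonneg : (0 : ℝ) ≤ k)]

theorem summable_wzTerm (k : ℕ) :
    Summable fun n : ℕ => wzTerm n k * (6 * n + 1 + 4 * k) := by
  rw [← summable_nat_add_iff 1]
  refine Summable.of_norm_bounded ?_ fun n => abs_wzTerm_succ_mul_le n k
  exact ((summable_nat_add_iff 1).2
    (summable_geometric_mul_linear (by norm_num) (by norm_num) 6 1)).mul_left _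

theorem tendsto_mul_wzTerm (k : ℕ) :
    Tendsto (fun n : ℕ => 4 * (n : ℝ) * wzTerm n k) atTop (nhds 0) := by
  refine squeeze_zero_norm (fun n => ?_) (summable_wzTerm k).norm.tendsto_atTop_zero
  rw [norm_mul, norm_mul _ (6 * (n : ℝ) + 1 + 4 * k), mul_comm,
    norm_of_nonneg (r := 4 * (n : ℝ)) (by positivity),
    norm_of_nonneg (r := 6 * (n : ℝ) + 1 + 4 * k) (by positivity)]
  gcongr
  linarith [(n.cast_nonneg : (0 : ℝ) ≤ n), (k.cast_nonneg : (0 : ℝ) ≤ k)]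

theorem tsum_wzTerm_succ (k : ℕ) :
    ∑' n : ℕ, wzTerm n (k + 1) * (6 * n + 1 + 4 * (k + 1 : ℕ)) =
      ∑' n : ℕ, wzTerm n k * (6 * n + 1 + 4 * k) := by
  have h := ((summable_wzTerm (k + 1)).hasSum.sub (summable_wzTerm k).hasSum).tendsto_sum_nat
  simp only [wz_pair] at h
  simp only [Finset.sum_range_sub (fun n : ℕ => 4 * (n : ℝ) * wzTerm n k)] at h
  have h0 := (tendsto_mul_wzTerm k).sub_const (4 * ((0 : ℕ) : ℝ) * wzTerm 0 k)
  have := tendsto_nhds_unique h h0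
  simp only [Nat.cast_zero] at this
  linarith

theorem tsum_wzTerm_eq (k : ℕ) :
    ∑' n : ℕ, wzTerm n k * (6 * n + 1 + 4 * k) =
      ∑' n : ℕ, wzTerm n 0 * (6 * n + 1 + 4 * (0 : ℕ)) := by
  induction k with
  | zero => rfl
  | succ k ih => rw [tsum_wzTerm_succ, ih]

theorem tendsto_wzTerm_zero_left :
    Tendsto (fun k : ℕ => wzTerm 0 k * (4 * k + 1)) atTop (nhds (2 * √2 / π)) := by
  have hW := Wallis.tendsto_W_nhds_pi_div_two
  have hW2 : Tendsto (fun k : ℕ => Wallis.W (2 * k)) atTop (nhds (π / 2)) :=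
    hW.comp (tendsto_id.const_mul_atTop' two_pos)
  have hr : Tendsto (fun k : ℕ => 2 - 1 / (2 * (k : ℝ) + 1)) atTop (nhds (2 - 0)) := by
    refine (tendsto_const_nhds.div_atTop ?_).const_sub _
    exact tendsto_atTop_add_const_right _ _ (tendsto_natCast_atTop_atTop.const_mul_atTop two_pos)
  have hpi : π / 2 * (π / 2) ≠ 0 := by positivity
  have h := ((hr.div (hW2.mul hW) hpi)).sqrt
  have e : √((2 - 0) / (π / 2 * (π / 2))) = 2 * √2 / π := by
    rw [Real.sqrt_eq_iff_eq_sq (by positivity) (by positivity), div_pow, mul_pow,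
      Real.sq_sqrt (by norm_num)]
    field_simp
    norm_num
  rw [e] at h
  refine h.congr fun k => ?_
  have hk := wzTerm_zero_left_pos k
  have h1 := Wallis.W_pos k
  have h2 := Wallis.W_pos (2 * k)
  rw [← Real.sqrt_sq (x := wzTerm 0 k * (4 * k + 1)) (by positivity)]
  congr 1
  rw [mul_pow, wzTerm_zero_left, mul_pow, sq_poch_half_div_factorial, sq_poch_half_div_factorial]
  simp only [Pi.div_apply]
  push_cast
  field_simp
  ring

theorem tendsto_wzTerm_zero : Tendsto (fun k : ℕ => wzTerm 0 k) atTop (nhds 0) := by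
  have h : Tendsto (fun k : ℕ => 4 * (k : ℝ) + 1) atTop atTop :=
    tendsto_atTop_add_const_right _ _
      (tendsto_natCast_atTop_atTop.const_mul_atTop (by norm_num))
  refine (tendsto_wzTerm_zero_left.div_atTop h).congr fun k => ?_
  field_simp

/-- Ramanujan's series `∑ (1/2)_n³ / n!³ (6n + 1) (-1/8)^n = 2√2/π`. -/
theorem tsum_wzTerm_zero :
    ∑' n : ℕ, wzTerm n 0 * (6 * n + 1 + 4 * (0 : ℕ)) = 2 * √2 / π := by
  set K := ∑' n : ℕ, (1 / 4 : ℝ) ^ (n + 1) * (6 * (n + 1 : ℕ) + 1)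
  have hK : Summable fun n : ℕ => (1 / 4 : ℝ) ^ (n + 1) * (6 * (n + 1 : ℕ) + 1) :=
    (summable_nat_add_iff 1).2 (summable_geometric_mul_linear (by norm_num) (by norm_num) 6 1)
  have htail : Tendsto (fun k : ℕ => ∑' n : ℕ,
      wzTerm (n + 1) k * (6 * (n + 1 : ℕ) + 1 + 4 * k)) atTop (nhds 0) := by
    refine squeeze_zero_norm (a := fun k => wzTerm 0 k * K) (fun k => ?_)
      (by simpa using tendsto_wzTerm_zero.mul_const K)
    exact tsum_of_norm_bounded (hK.hasSum.mul_left _) fun n => abs_wzTerm_succ_mul_le n k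
  have h := tendsto_wzTerm_zero_left.add htail
  rw [add_zero] at h
  refine tendsto_nhds_unique (tendsto_const_nhds.congr fun k => ?_) h
  rw [← tsum_wzTerm_eq k, (summable_wzTerm k).tsum_eq_zero_add]
  push_cast
  ring

theorem sum_whipple (m : ℕ) :
    ∑ n ∈ Finset.range (m + 1), (-1) ^ n * poch (1 / 2) n * poch (1 / 2) (m + n) * m.choose n /
      (n.factorial ^ 2 * m.factorial) = (poch (1 / 2) m / m.factorial) ^ 3 := by
  induction m with
  | zero => simp [poch_zero]
  | succ m ih =>
    set s : ℕ → ℕ → ℝ := fun m n => (-1) ^ n * poch (1 / 2) n * poch (1 / 2) (m + n) *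
      m.choose n / (n.factorial ^ 2 * m.factorial)
    set g : ℕ → ℝ := fun n => -(2 * m + 3 / 2) * n ^ 3 * ((-1) ^ n * poch (1 / 2) n *
      poch (1 / 2) (m + n) * (m + 1).choose n / (n.factorial ^ 2 * (m + 1).factorial))
    have hstep (n : ℕ) :
        (m + 1) ^ 3 * s (m + 1) n - (m + 1 / 2) ^ 3 * s m n = g (n + 1) - g n := by
      have h1 : ((m + 1).choose (n + 1) : ℝ) = (m + 1).choose n * (m + 1 - n) / (n + 1) := by
        rw [eq_div_iff (by positivity)]
        rcases le_or_gt n (m + 1) with h | h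
        · have := congrArg (Nat.cast (R := ℝ)) (Nat.choose_succ_right_eq (m + 1) n)
          push_cast [Nat.cast_sub h] at this
          exact this
        · simp [Nat.choose_eq_zero_of_lt h, Nat.choose_eq_zero_of_lt (h.trans n.lt_succ_self)]
      have h2 : (m.choose n : ℝ) = (m + 1).choose n * (m + 1 - n) / (m + 1) := by
        rw [eq_div_iff (by positivity)]
        rcases le_or_gt n (m + 1) with h | h
        · have := congrArg (Nat.cast (R := ℝ)) (Nat.choose_mul_succ_eq m n)
          push_cast [Nat.cast_sub h] at this
          exact this
        · simp [Nat.choose_eq_zero_of_lt h, Nat.choose_eq_zero_of_lt (m.lt_succ_self.trans h)]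
      simp only [s, g]
      rw [h1, h2, ← add_assoc, show m + 1 + n = m + n + 1 by ring, poch_succ, poch_succ,
        Nat.factorial_succ, Nat.factorial_succ, pow_succ]
      push_cast
      field_simp
      ring
    have htel := Finset.sum_range_sub g (m + 2)
    have hg0 : g 0 = 0 := by simp [g]
    have hg : g (m + 2) = 0 := by simp [g]
    have hs : s m (m + 1) = 0 := by simp [s]
    simp only [← hstep] at htel
    rw [Finset.sum_sub_distrib, ← Finset.mul_sum, ← Finset.mul_sum, hg, hg0,
      Finset.sum_range_succ (s m), hs, ih] at htel
    rw [poch_succ, Nat.factorial_succ]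
    have hm : ((m : ℝ) + 1) ^ 3 ≠ 0 := by positivity
    refine mul_left_cancel₀ hm (Eq.trans (sub_eq_zero.1 (htel.trans (sub_zero 0))) ?_)
    push_cast
    field_simp
    ring

theorem choose_add_le (N j : ℕ) : ((N + j).choose j : ℝ) ≤ (7 / 6) ^ N * 7 ^ j := by
  have h := Finset.single_le_sum (f := fun i => (1 / 7 : ℝ) ^ i * (6 / 7) ^ (N + j - i) *
    (N + j).choose i) (fun i _ => by positivity) (Finset.mem_range.2 (by omega : j < N + j + 1))
  rw [← add_pow, Nat.add_sub_cancel] at h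
  norm_num at h
  calc ((N + j).choose j : ℝ)
      = (7 / 6) ^ N * 7 ^ j * ((1 / 7) ^ j * (6 / 7) ^ N * (N + j).choose j) := by
        simp only [div_pow, one_pow]
        field_simp
    _ ≤ (7 / 6) ^ N * 7 ^ j * 1 := by
        gcongr
    _ = _ := mul_one _

theorem poch_half_add_div_factorial_le (N j : ℕ) :
    poch (1 / 2) (N + j) / j.factorial ≤ N.factorial * ((7 / 6) ^ N * 7 ^ j) := by
  rw [div_le_iff₀ (by positivity)]
  refine (poch_half_le_factorial _).trans ?_
  have h : ((N + j).factorial : ℝ) = N.factorial * (N + j).choose j * j.factorial := by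
    rw [← Nat.add_choose_mul_factorial_mul_factorial]
    push_cast
    ring
  rw [h]
  gcongr
  exact choose_add_le N j

/-- The summand of the double series obtained by expanding
`∑ (1/4)_n (1/2)_n (3/4)_n / n!³ (-4z)^n (1 - z)^(-1/2 - 2n)` in powers of `z = -1/8`. -/
noncomputable def whippleTerm (x : ℕ × ℕ) : ℝ :=
  (6 * (x.1 + x.2) + 1) * ((-1) ^ x.1 * poch (1 / 2) x.1 * poch (1 / 2) (2 * x.1 + x.2) /
    (x.1.factorial ^ 3 * x.2.factorial)) * (-1 / 8) ^ (x.1 + x.2)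

theorem sum_antidiagonal_whippleTerm (m : ℕ) :
    ∑ x ∈ Finset.HasAntidiagonal.antidiagonal m, whippleTerm x = wzTerm m 0 * (6 * m + 1 + 4 * (0 : ℕ)) := by
  have h : wzTerm m 0 * (6 * m + 1 + 4 * (0 : ℕ)) =
      (6 * m + 1) * (-1 / 8) ^ m * (poch (1 / 2) m / m.factorial) ^ 3 := by
    simp only [wzTerm, mul_zero, zero_add, add_zero, pow_zero]
    push_cast
    field_simp
    ring
  rw [h, ← sum_whipple, Finset.mul_sum, Finset.Nat.sum_antidiagonal_eq_sum_range_succ_mk]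
  refine Finset.sum_congr rfl fun n hn => ?_
  have hn : n ≤ m := Nat.lt_succ_iff.1 (Finset.mem_range.1 hn)
  simp only [whippleTerm]
  rw [Nat.cast_choose ℝ hn, show 2 * n + (m - n) = m + n by omega, Nat.add_sub_cancel' hn,
    Nat.cast_sub hn]
  field_simp
  ring

theorem abs_whippleTerm_le (n j : ℕ) :
    |whippleTerm (n, j)| ≤ ((49 / 72) ^ n * (6 * n + 1)) * ((7 / 8) ^ j * (6 * j + 1)) := by
  have hp := poch_pos (a := 1 / 2) (by norm_num)
  have h1 := hp n
  have h2 := hp (2 * n + j)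
  have habs : |whippleTerm (n, j)| = (6 * (n + j) + 1) * (poch (1 / 2) n / n.factorial *
      (poch (1 / 2) (2 * n + j) / j.factorial) / n.factorial ^ 2) * (1 / 8) ^ (n + j) := by
    simp only [whippleTerm]
    rw [abs_mul, abs_mul, abs_div, abs_mul, abs_mul, abs_pow, abs_pow, abs_of_pos h1,
      abs_of_pos h2, abs_of_nonneg (a := 6 * ((n : ℝ) + j) + 1) (by positivity),
      abs_of_nonneg (a := (n.factorial : ℝ) ^ 3 * j.factorial) (by positivity)]
    rw [show |(-1 / 8 : ℝ)| = 1 / 8 by norm_num [abs_div], abs_neg, abs_one, one_pow, one_mul]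
    field_simp
  have h3 : ((2 * n).factorial : ℝ) / n.factorial ^ 2 ≤ 4 ^ n := by
    rw [div_le_iff₀ (by positivity), factorial_two_mul_eq, sq, ← mul_assoc]
    gcongr
    exact poch_half_le_factorial n
  calc |whippleTerm (n, j)|
      ≤ ((6 * n + 1) * (6 * j + 1)) *
        (1 * ((2 * n).factorial * ((7 / 6) ^ (2 * n) * 7 ^ j)) / n.factorial ^ 2) *
          (1 / 8) ^ (n + j) := by
        rw [habs]
        gcongr
        · nlinarith [mul_nonneg (n.cast_nonneg : (0 : ℝ) ≤ n) (j.cast_nonneg : (0 : ℝ) ≤ j)]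
        · exact (div_le_one (by positivity)).2 (poch_half_le_factorial n)
        · exact poch_half_add_div_factorial_le _ _
    _ = ((6 * n + 1) * (6 * j + 1)) * ((2 * n).factorial / n.factorial ^ 2) *
          ((7 / 6) ^ (2 * n) * 7 ^ j * (1 / 8) ^ (n + j)) := by ring
    _ ≤ ((6 * n + 1) * (6 * j + 1)) * 4 ^ n * ((7 / 6) ^ (2 * n) * 7 ^ j * (1 / 8) ^ (n + j)) := by
        gcongr
    _ = ((6 * n + 1) * (6 * j + 1)) * ((4 * (7 / 6) ^ 2 * (1 / 8)) ^ n * (7 * (1 / 8)) ^ j) := by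
        rw [mul_pow, mul_pow, mul_pow, pow_mul, pow_add]
        ring
    _ = _ := by
        norm_num
        ring

theorem summable_whippleTerm : Summable whippleTerm := by
  refine Summable.of_norm_bounded ?_ fun x => abs_whippleTerm_le x.1 x.2
  exact (summable_geometric_mul_linear (by norm_num) (by norm_num) 6 1).mul_of_nonneg
    (summable_geometric_mul_linear (by norm_num) (by norm_num) 6 1)
    (fun n => by positivity) (fun n => by positivity)

theorem summable_poch_half_shift (N : ℕ) :
    Summable fun j : ℕ => poch (1 / 2) (N + j) / j.factorial * (-1 / 8 : ℝ) ^ j := by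
  refine Summable.of_norm_bounded
    ((summable_geometric_of_lt_one (r := 7 / 8) (by norm_num) (by norm_num)).mul_left
      ((N.factorial : ℝ) * (7 / 6) ^ N)) fun j => ?_
  have h := poch_pos (a := 1 / 2) (by norm_num) (N + j)
  rw [norm_mul, norm_of_nonneg (by positivity), norm_pow]
  calc poch (1 / 2) (N + j) / j.factorial * ‖(-1 / 8 : ℝ)‖ ^ j
      ≤ N.factorial * ((7 / 6) ^ N * 7 ^ j) * ‖(-1 / 8 : ℝ)‖ ^ j := by
        gcongr
        exact poch_half_add_div_factorial_le N j
    _ = N.factorial * (7 / 6) ^ N * (7 * ‖(-1 / 8 : ℝ)‖) ^ j := by ring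
    _ = _ := by norm_num

theorem hasSum_natCast_mul_poch_half_shift (N : ℕ) :
    HasSum (fun j : ℕ => j * (poch (1 / 2) (N + j) / j.factorial * (-1 / 8 : ℝ) ^ j))
      (-1 / 8 * ∑' j : ℕ, poch (1 / 2) (N + 1 + j) / j.factorial * (-1 / 8 : ℝ) ^ j) := by
  rw [← hasSum_nat_add_iff' 1]
  simp only [Finset.sum_range_one, Nat.cast_zero, zero_mul, sub_zero]
  refine ((summable_poch_half_shift (N + 1)).hasSum.mul_left (-1 / 8)).congr_fun fun j => ?_
  rw [show N + (j + 1) = N + 1 + j by ring, Nat.factorial_succ, pow_succ]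
  push_cast
  field_simp

theorem tsum_poch_half_shift_succ (N : ℕ) :
    ∑' j : ℕ, poch (1 / 2) (N + 1 + j) / j.factorial * (-1 / 8 : ℝ) ^ j =
      (N + 1 / 2) * (8 / 9) *
        ∑' j : ℕ, poch (1 / 2) (N + j) / j.factorial * (-1 / 8 : ℝ) ^ j := by
  have h := ((summable_poch_half_shift N).hasSum.mul_left ((N : ℝ) + 1 / 2)).add
    (hasSum_natCast_mul_poch_half_shift N)
  have h' := h.unique ((summable_poch_half_shift (N + 1)).hasSum.congr_fun fun j => ?_)
  · linarith
  · rw [show N + 1 + j = N + j + 1 by ring, poch_succ]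
    push_cast
    ring

theorem tsum_poch_half :
    ∑' j : ℕ, poch (1 / 2) (0 + j) / j.factorial * (-1 / 8 : ℝ) ^ j = 2 * √2 / 3 := by
  have h := (one_div_one_sub_rpow_hasFPowerSeriesOnBall_zero (1 / 2)).hasSum
    (y := (-1 / 8 : ℝ)) (by simp [enorm_eq_nnnorm])
  have e : 1 / (1 - (0 + -1 / 8 : ℝ)) ^ (1 / 2 : ℝ) = 2 * √2 / 3 := by
    rw [← Real.sqrt_eq_rpow, one_div, ← Real.sqrt_inv,
      Real.sqrt_eq_iff_eq_sq (by norm_num) (by positivity), div_pow, mul_pow,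
      Real.sq_sqrt (by norm_num)]
    norm_num
  rw [e] at h
  rw [← h.tsum_eq]
  refine tsum_congr fun j => ?_
  have hc : (j.factorial : ℝ) * Ring.choose (1 / 2 + (j : ℝ) - 1) j = poch (1 / 2) j := by
    have := Ring.factorial_nsmul_multichoose_eq_ascPochhammer (1 / 2 : ℝ) j
    rw [Polynomial.ascPochhammer_smeval_eq_eval, nsmul_eq_mul] at this
    rw [poch, ← this, Ring.choose]
    congr 2
    ring
  rw [zero_add, ← hc, mul_div_cancel_left₀ _ (by positivity)]
  simp [FormalMultilinearSeries.ofScalars]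

theorem tsum_poch_half_shift (N : ℕ) :
    ∑' j : ℕ, poch (1 / 2) (N + j) / j.factorial * (-1 / 8 : ℝ) ^ j =
      poch (1 / 2) N * (8 / 9) ^ N * (2 * √2 / 3) := by
  induction N with
  | zero => rw [tsum_poch_half, poch_zero]; ring
  | succ N ih => rw [tsum_poch_half_shift_succ, ih, poch_succ]; ring

theorem hasSum_whippleTerm_right (n : ℕ) :
    HasSum (fun j => whippleTerm (n, j)) (4 * √2 / 9 *
      ((poch (1 / 4) n * poch (1 / 2) n * poch (3 / 4) n / (n.factorial : ℝ) ^ 3) *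
        (32 / 81) ^ n * (1 + 7 * (n : ℝ)))) := by
  have h := (((summable_poch_half_shift (2 * n)).hasSum.mul_left (6 * (n : ℝ) + 1)).add
    ((hasSum_natCast_mul_poch_half_shift (2 * n)).mul_left 6)).mul_left
      (poch (1 / 2) n / n.factorial ^ 3 * (1 / 8) ^ n)
  rw [tsum_poch_half_shift_succ, tsum_poch_half_shift] at h
  convert! h using 1
  · ext j
    have e : (-1 / 8 : ℝ) ^ n = (-1) ^ n * (1 / 8) ^ n := by rw [← mul_pow]; norm_num
    have e' : ((-1 : ℝ) ^ n) * (-1) ^ n = 1 := by rw [← mul_pow]; norm_num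
    simp only [whippleTerm]
    rw [pow_add, e]
    linear_combination (6 * (n + j) + 1) * (poch (1 / 2) n * poch (1 / 2) (2 * n + j) /
      (n.factorial ^ 3 * j.factorial)) * (1 / 8) ^ n * (-1 / 8 : ℝ) ^ j * e'
  · have e : (32 / 81 : ℝ) ^ n = 4 ^ n * ((1 / 8) ^ n * (8 / 9) ^ (2 * n)) := by
      rw [pow_mul, ← mul_pow, ← mul_pow]; norm_num
    rw [mul_right_comm (poch (1 / 4) n), poch_quarter_mul_poch_three_quarters, e]
    push_cast
    field_simp
    ring

theorem stmt12 :
    Tendsto (fun N => ∑ n ∈ Finset.range N,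
      (poch (1 / 4) n * poch (1 / 2) n * poch (3 / 4) n / (n.factorial : ℝ) ^ 3) *
        (32 / 81) ^ n * (1 + 7 * (n : ℝ)))
      atTop (nhds (9 / (2 * π))) := by
  have hdiag := (Finset.HasAntidiagonal.sigmaAntidiagonalEquivProd.hasSum_iff.2
    summable_whippleTerm.hasSum).sigma (fun m => hasSum_fintype _)
  have hsum : ∑' x, whippleTerm x = 2 * √2 / π := by
    rw [← tsum_wzTerm_zero, ← hdiag.tsum_eq]
    refine tsum_congr fun m => ?_
    rw [← sum_antidiagonal_whippleTerm]
    exact Finset.sum_coe_sort _ whippleTerm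
  have hrow := summable_whippleTerm.hasSum.prod_fiberwise hasSum_whippleTerm_right
  rw [hsum] at hrow
  have h2 : (4 * √2 / 9)⁻¹ * (2 * √2 / π) = 9 / (2 * π) := by
    field_simp
    norm_num
  have h := hrow.mul_left (4 * √2 / 9)⁻¹
  simp only [inv_mul_cancel_left₀ (show 4 * √2 / 9 ≠ 0 by positivity), h2] at h
  exact h.tendsto_sum_nat
end
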